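/- arXiv:1508.04302 — 2 statements merged into one kernel-verified Lean document; each statement's English description precedes it below -/
import Mathlib

section
/- For every partially ordered set P that has a least element and a greatest element and contains at least two elements, and for every group G, there exists a selfdual lattice L of length sixteen such that Princ L is order-isomorphic to P and the automorphism group Aut L of L is isomorphic to G. -/
/-- A congruence of a lattice: an equivalence relation compatible with `⊔` and `⊓`. -/
structure LatCon (L : Type*) [Lattice L] where
  rel : L → L → Prop
  refl : ∀ x, rel x x
  symm : ∀ {x y}, rel x y → rel y x
  trans : ∀ {x y z}, rel x y → rel y z → rel x z
  sup : ∀ {x₁ y₁ x₂ y₂}, rel x₁ y₁ → rel x₂ y₂ → rel (x₁ ⊔ x₂) (y₁ ⊔ y₂)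
  inf : ∀ {x₁ y₁ x₂ y₂}, rel x₁ y₁ → rel x₂ y₂ → rel (x₁ ⊓ x₂) (y₁ ⊓ y₂)

/-- The principal congruence `cg(a,b)`: the smallest congruence collapsing `a` and `b`. -/
def latCg {L : Type*} [Lattice L] (a b : L) : L → L → Prop :=
  fun x y => ∀ θ : LatCon L, θ.rel a b → θ.rel x y

/-- `Princ L`: the set of principal congruences of `L`, ordered by inclusion. -/
def Princ (L : Type*) [Lattice L] :=
  {r : L → L → Prop // ∃ a b : L, a ≤ b ∧ r = latCg a b}

instance (L : Type*) [Lattice L] : PartialOrder (Princ L) :=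
  Subtype.partialOrder _

/-- A lattice has length `n` if it contains a chain of `n+1` elements and every
chain in it has at most `n+1` elements. -/
def LatLength (L : Type*) [Lattice L] (n : ℕ) : Prop :=
  (∃ C : Set L, IsChain (· ≤ ·) C ∧ C.Finite ∧ C.ncard = n + 1) ∧
  (∀ C : Set L, IsChain (· ≤ ·) C → C.Finite ∧ C.ncard ≤ n + 1)

universe u v w

/-- A partial linear space with positioned points. -/
structure Geo (Λ : Type w) (Y : Type w) where
  len : Λ → ℕ
  coord : Λ → ℕ → Y
  three_le : ∀ r, 3 ≤ len r
  lin : ∀ r s i j, i ≠ j → coord r i = coord s i → coord r j = coord s j → r = s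
  off : ∀ r, ∃ s i, i < len s ∧ coord s i ≠ coord r i

namespace Geo

variable {Λ Y : Type w}

@[ext]
structure Pt (X : Geo Λ Y) where
  i : ℕ
  v : Y
  h : ∃ r, i < X.len r ∧ X.coord r i = v

def inc (X : Geo Λ Y) (r : Λ) (x : X.Pt) : Prop := x.i < X.len r ∧ X.coord r x.i = x.v

def p (X : Geo Λ Y) (r : Λ) (i : ℕ) (h : i < X.len r) : X.Pt := ⟨i, X.coord r i, r, h, rfl⟩

theorem inc_p (X : Geo Λ Y) (r : Λ) (i : ℕ) (h : i < X.len r) : X.inc r (X.p r i h) := ⟨h, rfl⟩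

theorem inc_eq {X : Geo Λ Y} {r s : Λ} {x y : X.Pt} (hxy : x ≠ y)
    (h1 : X.inc r x) (h2 : X.inc r y) (h3 : X.inc s x) (h4 : X.inc s y) : r = s := by
  have hi : x.i ≠ y.i := by
    intro hi
    apply hxy
    ext
    · exact hi
    · rw [← h1.2, ← h2.2, hi]
  exact X.lin r s x.i y.i hi (h1.2.trans h3.2.symm) (h2.2.trans h4.2.symm)

theorem pt_eq {X : Geo Λ Y} {r s : Λ} {x y : X.Pt} (hrs : r ≠ s)
    (h1 : X.inc r x) (h2 : X.inc r y) (h3 : X.inc s x) (h4 : X.inc s y) : x = y := by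
  by_contra h
  exact hrs (inc_eq h h1 h2 h3 h4)

theorem inc_i {X : Geo Λ Y} {r : Λ} {x y : X.Pt} 
    (h1 : X.inc r x) (h2 : X.inc r y) (h : x.i = y.i) : x = y := by
  ext
  · exact h
  · rw [← h1.2, ← h2.2, h]

inductive BB (X : Geo Λ Y) : Type w
  | bot : BB X
  | top : BB X
  | pt (x : X.Pt) (k : Fin 3) : BB X
  | up (r : Λ) (j : ℕ) (h : j < X.len r) : BB X
  | dn (r : Λ) (j : ℕ) (h : j < X.len r) : BB X

namespace BB

variable {X : Geo Λ Y}

def le : BB X → BB X → Prop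
  | bot, _ => True
  | _, top => True
  | pt x k, pt y l => x = y ∧ k ≤ l
  | pt x k, up r j _ => k = 0 ∧ X.inc r x ∧ x.i ≤ j
  | up r i _, up s j _ => r = s ∧ i ≤ j
  | dn r i _, dn s j _ => r = s ∧ j ≤ i
  | dn r j _, pt x k => k = 2 ∧ X.inc r x ∧ x.i ≤ j
  | _, _ => False

theorem le_refl' (a : BB X) : le a a := by cases a <;> simp [le]

theorem le_antisymm' (a b : BB X) (h1 : le a b) (h2 : le b a) : a = b := by
  cases a <;> cases b <;> simp [le] at * <;> grind

theorem le_trans' (a b c : BB X) (h1 : le a b) (h2 : le b c) : le a c := by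
  cases a <;> cases b <;> cases c <;> simp only [le] at * <;> grind

instance : PartialOrder (BB X) where
  le := le
  le_refl := le_refl'
  le_trans := le_trans'
  le_antisymm := le_antisymm'

theorem le_def (a b : BB X) : a ≤ b ↔ le a b := Iff.rfl

instance : BoundedOrder (BB X) where
  top := top
  bot := bot
  le_top a := by cases a <;> trivial
  bot_le a := by trivial

theorem top_def : (⊤ : BB X) = top := rfl
theorem bot_def : (⊥ : BB X) = bot := rfl

def D : BB X → BB X
  | bot => top
  | top => bot
  | pt x k => pt x (Fin.rev k)
  | up r j h => dn r j h
  | dn r j h => up r j h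

@[simp] theorem D_D (a : BB X) : D (D a) = a := by cases a <;> simp [D]

theorem D_le_aux (a b : BB X) (h : a ≤ b) : D b ≤ D a := by
  rw [le_def] at *
  have key : ∀ k : Fin 3, k = 0 → Fin.rev k = 2 := by decide
  have key2 : ∀ k : Fin 3, k = 2 → Fin.rev k = 0 := by decide
  cases a <;> cases b <;> simp only [le, D] at * <;> grind

theorem D_le (a b : BB X) : D b ≤ D a ↔ a ≤ b :=
  ⟨fun h => by simpa using D_le_aux _ _ h, D_le_aux a b⟩

theorem exists_lub (a b : BB X) : ∃ c, a ≤ c ∧ b ≤ c ∧ ∀ d, a ≤ d → b ≤ d → c ≤ d := by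
  by_cases hab : a ≤ b
  · exact ⟨b, hab, le_rfl, fun d _ h => h⟩
  by_cases hba : b ≤ a
  · exact ⟨a, le_rfl, hba, fun d h _ => h⟩
  by_cases htop : ∀ d, a ≤ d → b ≤ d → d = ⊤
  · exact ⟨⊤, le_top, le_top, fun d h1 h2 => (htop d h1 h2).ge⟩
  push Not at htop
  obtain ⟨d, h1, h2, h3⟩ := htop
  cases d with
  | bot => exact absurd (h1.trans bot_le) hab
  | top => exact absurd rfl h3
  | pt x k =>
    refine ⟨pt x k, h1, h2, fun d' h1' h2' => ?_⟩
    simp only [le_def] at *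
    cases a <;> cases b <;> simp only [le] at h1 h2 hab hba <;> cases d' <;> simp only [le] at * <;> try grind [pt_eq]
  | up r j h =>
    cases a with
    | bot => exact absurd bot_le hab
    | top => exact absurd (top_le_iff.1 h1) h3
    | dn => simp only [le_def, le] at h1
    | pt x k =>
      cases b with
      | bot => exact absurd bot_le hba
      | top => exact absurd (top_le_iff.1 h2) h3
      | dn => simp only [le_def, le] at h2
      | pt y l =>
        simp only [le_def, le] at h1 h2 hab hba
        have hxy : x ≠ y := by grind
        refine ⟨up r (max x.i y.i) (by grind), ?_, ?_, ?_⟩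
        · simp only [le_def, le]; grind
        · simp only [le_def, le]; grind
        · intro d' h1' h2'
          cases d' <;> simp only [le_def, le] at * 
          · grind
          · grind [inc_eq]
      | up s i hi =>
        simp only [le_def, le] at h1 h2 hab hba
        obtain ⟨rfl, h2⟩ := h2
        refine ⟨up s (max x.i i) (by grind), ?_, ?_, ?_⟩
        · simp only [le_def, le]; grind
        · simp only [le_def, le]; grind
        · intro d' h1' h2'
          cases d' <;> simp only [le_def, le] at * ; grind 
    | up s i hi =>
      simp only [le_def, le] at h1
      obtain ⟨rfl, h1⟩ := h1
      cases b with
      | bot => exact absurd bot_le hba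
      | top => exact absurd (top_le_iff.1 h2) h3
      | dn => simp only [le_def, le] at h2
      | pt y l =>
        simp only [le_def, le] at h2 hab hba
        refine ⟨up s (max y.i i) (by grind), ?_, ?_, ?_⟩
        · simp only [le_def, le]; grind
        · simp only [le_def, le]; grind
        · intro d' h1' h2'
          cases d' <;> simp only [le_def, le] at * ; grind 
      | up s i hi =>
        simp only [le_def, le] at h2 hab hba
        grind
  | dn r j h =>
    cases a <;> cases b <;> simp only [le_def, le] at * <;> grind

theorem exists_glb (a b : BB X) : ∃ c, c ≤ a ∧ c ≤ b ∧ ∀ d, d ≤ a → d ≤ b → d ≤ c := by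
  obtain ⟨c, h1, h2, h3⟩ := exists_lub (D a) (D b)
  refine ⟨D c, ?_, ?_, fun d hd1 hd2 => ?_⟩
  · rw [← D_le]; simpa using h1
  · rw [← D_le]; simpa using h2
  · rw [← D_le]; simpa using h3 (D d) ((D_le _ _).2 hd1) ((D_le _ _).2 hd2)

noncomputable instance : Lattice (BB X) where
  sup a b := (exists_lub a b).choose
  inf a b := (exists_glb a b).choose
  le_sup_left a b := (exists_lub a b).choose_spec.1
  le_sup_right a b := (exists_lub a b).choose_spec.2.1
  sup_le a b c := (exists_lub a b).choose_spec.2.2 c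
  inf_le_left a b := (exists_glb a b).choose_spec.1
  inf_le_right a b := (exists_glb a b).choose_spec.2.1
  le_inf a b c := (exists_glb b c).choose_spec.2.2 a

theorem sup_top {a b : BB X} (h : ∀ d, a ≤ d → b ≤ d → d = ⊤) : a ⊔ b = ⊤ :=
  h _ le_sup_left le_sup_right

theorem inf_bot {a b : BB X} (h : ∀ d, d ≤ a → d ≤ b → d = ⊥) : a ⊓ b = ⊥ :=
  h _ inf_le_left inf_le_right

theorem exists_line (x : X.Pt) : ∃ r, X.inc r x := by
  obtain ⟨r, h1, h2⟩ := x.h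
  exact ⟨r, h1, h2⟩

theorem sep_pt (x : X.Pt) (k l : Fin 3) (h : k < l) :
    (∃ w : BB X, pt x k ⊔ w ≠ ⊤ ∧ pt x l ⊔ w = ⊤) ∨
      (∃ w : BB X, pt x k ⊓ w = ⊥ ∧ pt x l ⊓ w ≠ ⊥) := by
  obtain ⟨r, hr⟩ := exists_line x
  by_cases hk : k = 0
  · subst hk
    left
    refine ⟨up r x.i hr.1, ?_, ?_⟩
    · have : pt x 0 ≤ up r x.i hr.1 := by rw [le_def]; exact ⟨rfl, hr, le_rfl⟩
      rw [sup_eq_right.2 this]; simp [top_def]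
    · apply sup_top
      intro d h1 h2
      cases d <;> simp only [le_def, le, top_def] at * <;> grind
  · right
    have hl : l = 2 := by omega
    subst hl
    refine ⟨dn r x.i hr.1, ?_, ?_⟩
    · apply inf_bot
      intro d h1 h2
      cases d <;> simp only [le_def, le, bot_def] at * <;> grind
    · have : dn r x.i hr.1 ≤ pt x 2 := by rw [le_def]; exact ⟨rfl, hr, le_rfl⟩
      rw [inf_eq_right.2 this]; simp [bot_def]

theorem sep {a b : BB X} (h : a < b) :
    (∃ w : BB X, a ⊔ w ≠ ⊤ ∧ b ⊔ w = ⊤) ∨ (∃ w : BB X, a ⊓ w = ⊥ ∧ b ⊓ w ≠ ⊥) := by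
  have hle := h.le
  have hne := h.ne
  cases a with
  | bot => right; refine ⟨b, ?_, ?_⟩
           · exact bot_inf_eq b
           · rw [inf_idem]; exact hne.symm
  | top => exact absurd (top_le_iff.1 hle).symm hne
  | pt x k =>
    cases b with
    | bot => exact absurd (le_bot_iff.1 hle) hne
    | top => left; refine ⟨⊥, ?_, ?_⟩
             · simpa using hne
             · exact top_sup_eq _
    | pt y l =>
      simp only [le_def, le] at hle
      obtain ⟨rfl, hkl⟩ := hle
      exact sep_pt x k l (lt_of_le_of_ne hkl (by grind))
    | up r j hj =>
      left
      refine ⟨pt x 1, ?_, ?_⟩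
      · have : pt x k ≤ pt x 1 := by
          rw [le_def] at *; exact ⟨rfl, by rw [hle.1]; decide⟩
        rw [sup_eq_right.2 this]; simp [top_def]
      · apply sup_top
        intro d h1 h2
        cases d <;> simp only [le_def, le, top_def] at * <;> grind
    | dn => simp only [le_def, le] at hle
  | up r j hj =>
    cases b with
    | bot => exact absurd (le_bot_iff.1 hle) hne
    | top => left; refine ⟨⊥, ?_, ?_⟩
             · simpa using hne
             · exact top_sup_eq _
    | pt y l => simp only [le_def, le] at hle
    | up s i hi =>
      right
      simp only [le_def, le] at hle
      obtain ⟨rfl, hij⟩ := hle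
      refine ⟨pt (X.p r i hi) 0, ?_, ?_⟩
      · apply inf_bot
        intro d h1 h2
        cases d <;> simp only [le_def, le, bot_def] at * <;> grind [p]
      · have : pt (X.p r i hi) 0 ≤ up r i hi := by
          rw [le_def]; exact ⟨rfl, X.inc_p _ _ _, le_rfl⟩
        rw [inf_eq_right.2 this]; simp [bot_def]
    | dn => simp only [le_def, le] at hle
  | dn r j hj =>
    cases b with
    | bot => exact absurd (le_bot_iff.1 hle) hne
    | top => left; refine ⟨⊥, ?_, ?_⟩
             · simpa using hne
             · exact top_sup_eq _
    | pt y l => 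
      right
      refine ⟨pt y 1, ?_, ?_⟩
      · apply inf_bot
        intro d h1 h2
        cases d <;> simp only [le_def, le, bot_def] at * <;> grind
      · have : pt y 1 ≤ pt y l := by
          rw [le_def] at *; exact ⟨rfl, by rw [hle.1]; decide⟩
        rw [inf_eq_right.2 this]; simp [bot_def]
    | up => simp only [le_def, le] at hle
    | dn s i hi =>
      left
      simp only [le_def, le] at hle
      obtain ⟨rfl, hij⟩ := hle
      refine ⟨pt (X.p r j hj) 2, ?_, ?_⟩
      · have : dn r j hj ≤ pt (X.p r j hj) 2 := by
          rw [le_def]; exact ⟨rfl, X.inc_p _ _ _, le_rfl⟩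
        rw [sup_eq_right.2 this]; simp [top_def]
      · apply sup_top
        intro d h1 h2
        cases d <;> simp only [le_def, le, top_def] at * <;> grind [p]

theorem mid_sup {x : X.Pt} {b : BB X} (hb : ¬ b ≤ pt x 2) : pt x 1 ⊔ b = ⊤ := by
  apply sup_top
  intro d h1 h2
  cases d <;> cases b <;> simp only [le_def, le, top_def, bot_def] at * <;> grind

theorem mid_inf {x : X.Pt} {b : BB X} (hb : ¬ pt x 0 ≤ b) : pt x 1 ⊓ b = ⊥ := by
  apply inf_bot
  intro d h1 h2
  cases d <;> cases b <;> simp only [le_def, le, top_def, bot_def] at * <;> grind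

theorem exists_not_le {b : BB X} (hb : b ≠ ⊥) (hΛ : Nonempty Λ) : ∃ x, ¬ b ≤ pt x 2 := by
  obtain ⟨r0⟩ := hΛ
  have h3 := X.three_le r0
  cases b with
  | bot => exact absurd rfl hb
  | top => exact ⟨X.p r0 0 (by omega), by simp [le_def, le]⟩
  | up => exact ⟨X.p r0 0 (by omega), by simp [le_def, le]⟩
  | pt x k =>
    by_cases h : x.i = 0
    · refine ⟨X.p r0 1 (by omega), ?_⟩
      simp only [le_def, le]
      rintro ⟨e, -⟩
      rw [e] at h
      simp [p] at h
    · refine ⟨X.p r0 0 (by omega), ?_⟩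
      simp only [le_def, le]
      rintro ⟨e, -⟩
      rw [e] at h
      simp [p] at h
  | dn r j h =>
    obtain ⟨s, i, hi, hs⟩ := X.off r
    refine ⟨X.p s i hi, ?_⟩
    simp only [le_def, le]
    rintro ⟨-, ⟨-, h2⟩, -⟩
    exact hs h2.symm

theorem exists_not_ge {b : BB X} (hb : b ≠ ⊤) (hΛ : Nonempty Λ) : ∃ x, ¬ pt x 0 ≤ b := by
  obtain ⟨x, hx⟩ := exists_not_le (b := D b) (by cases b <;> simp_all [D, top_def, bot_def]) hΛ
  refine ⟨x, fun h => hx ?_⟩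
  exact D_le_aux _ _ h

/-! ### Automorphisms of `BB` -/

def Mid (b : BB X) : Prop :=
  (∃ u, ∀ c, (b < c ∧ c ≠ ⊤) ↔ c = u) ∧ (∃ u, ∀ c, (c < b ∧ c ≠ ⊥) ↔ c = u)

theorem mid_pt (x : X.Pt) : Mid (pt x 1) := by
  constructor
  · refine ⟨pt x 2, fun c => ?_⟩
    rw [lt_iff_le_and_ne]
    cases c <;> simp only [le_def, le, top_def] <;> grind
  · refine ⟨pt x 0, fun c => ?_⟩
    rw [lt_iff_le_and_ne]
    cases c <;> simp only [le_def, le, bot_def] <;> grind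

theorem Mid.exists {b : BB X} (h : Mid b) : ∃ x, b = pt x 1 := by
  obtain ⟨⟨u, hu⟩, ⟨t, ht⟩⟩ := h
  have hu1 := (hu u).2 rfl
  have ht1 := (ht t).2 rfl
  cases b with
  | bot => exact absurd (lt_of_le_of_lt bot_le ht1.1) (lt_irrefl _)
  | top => exact absurd (lt_of_lt_of_le hu1.1 le_top) (lt_irrefl _)
  | pt x k =>
    refine ⟨x, ?_⟩
    rw [lt_iff_le_and_ne] at hu1 ht1
    by_cases h0 : k = 0
    · exfalso
      cases t <;> simp only [le_def, le, bot_def] at * <;> grind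
    by_cases h2 : k = 2
    · exfalso
      cases u <;> simp only [le_def, le, top_def] at * <;> grind
    have : k = 1 := by omega
    rw [this]
  | up r j hj =>
    exfalso
    have h3 := X.three_le r
    by_cases h0 : j = 0
    · have e1 := (hu (up r 1 (by omega))).1
      have e2 := (hu (up r 2 (by omega))).1
      simp only [lt_iff_le_and_ne, le_def, le, top_def] at e1 e2
      grind
    · have e1 := (ht (pt (X.p r 0 (by omega)) 0)).1
      have e2 := (ht (pt (X.p r 1 (by omega)) 0)).1
      have := X.inc_p r 0 (by omega)
      have := X.inc_p r 1 (by omega)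
      simp only [lt_iff_le_and_ne, le_def, le, bot_def] at e1 e2
      grind [p]
  | dn r j hj =>
    exfalso
    have h3 := X.three_le r
    by_cases h0 : j = 0
    · have e1 := (ht (dn r 1 (by omega))).1
      have e2 := (ht (dn r 2 (by omega))).1
      simp only [lt_iff_le_and_ne, le_def, le, bot_def] at e1 e2
      grind
    · have e1 := (hu (pt (X.p r 0 (by omega)) 2)).1
      have e2 := (hu (pt (X.p r 1 (by omega)) 2)).1
      have := X.inc_p r 0 (by omega)
      have := X.inc_p r 1 (by omega)
      simp only [lt_iff_le_and_ne, le_def, le, top_def] at e1 e2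
      grind [p]

theorem Mid.map (σ : BB X ≃o BB X) {b : BB X} (h : Mid b) : Mid (σ b) := by
  obtain ⟨⟨u, hu⟩, ⟨t, ht⟩⟩ := h
  refine ⟨⟨σ u, fun c => ?_⟩, ⟨σ t, fun c => ?_⟩⟩
  · obtain ⟨c, rfl⟩ := σ.surjective c
    rw [σ.lt_iff_lt, σ.injective.eq_iff, ← hu, Ne, map_eq_top_iff]
  · obtain ⟨c, rfl⟩ := σ.surjective c
    rw [σ.lt_iff_lt, σ.injective.eq_iff, ← ht, Ne, map_eq_bot_iff]

theorem aut_pt (σ : BB X ≃o BB X) (x : X.Pt) : ∃ y, ∀ k, σ (pt x k) = pt y k := by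
  obtain ⟨y, hy⟩ := ((mid_pt x).map σ).exists
  refine ⟨y, ?_⟩
  have h0 : σ (pt x 0) < σ (pt x 1) := σ.lt_iff_lt.2 (by
    simp only [lt_iff_le_and_ne, le_def, le]; grind)
  have h2 : σ (pt x 1) < σ (pt x 2) := σ.lt_iff_lt.2 (by
    simp only [lt_iff_le_and_ne, le_def, le]; grind)
  have h0' : σ (pt x 0) ≠ ⊥ := by rw [Ne, map_eq_bot_iff]; simp [bot_def]
  have h2' : σ (pt x 2) ≠ ⊤ := by rw [Ne, map_eq_top_iff]; simp [top_def]
  have e0 : σ (pt x 0) = pt y 0 := by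
    rw [hy] at h0
    generalize σ (pt x 0) = z at *
    cases z <;> simp only [lt_iff_le_and_ne, le_def, le, bot_def] at * <;> grind
  have e2 : σ (pt x 2) = pt y 2 := by
    rw [hy] at h2
    generalize σ (pt x 2) = z at *
    cases z <;> simp only [lt_iff_le_and_ne, le_def, le, top_def] at * <;> grind
  intro k
  fin_cases k
  · exact e0
  · exact hy
  · exact e2

theorem aut_up (σ : BB X ≃o BB X) (r : Λ) (j : ℕ) (h : j < X.len r) :
    ∃ s i hi, σ (up r j h) = up s i hi := by
  have h3 := X.three_le r
  have h1 : pt (X.p r 0 (by omega)) 0 ≤ up r j h := by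
    rw [le_def]; exact ⟨rfl, X.inc_p _ _ _, Nat.zero_le _⟩
  have h2 := σ.le_iff_le.2 h1
  obtain ⟨y, hy⟩ := aut_pt σ (X.p r 0 (by omega))
  rw [hy] at h2
  have h4 : ∀ x k, σ (up r j h) ≠ pt x k := by
    intro x k hx
    obtain ⟨z, hz⟩ := aut_pt σ.symm x
    have := hz k
    rw [← hx] at this
    simp at this
  have h5 : σ (up r j h) ≠ ⊤ := by rw [Ne, map_eq_top_iff]; simp [top_def]
  generalize σ (up r j h) = z at *
  cases z <;> simp only [le_def, le, top_def] at * <;> grind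

theorem aut_up_same (σ : BB X ≃o BB X) {r : Λ} {j j' : ℕ} {h h'} {s s' : Λ} {i i' : ℕ} {hi hi'}
    (e : σ (up r j h) = up s i hi) (e' : σ (up r j' h') = up s' i' hi') :
    s = s' ∧ (j < j' → i < i') := by
  rcases lt_trichotomy j j' with hj | hj | hj
  · have : up r j h < up r j' h' := by
      simp only [lt_iff_le_and_ne, le_def, le]; grind
    have := σ.lt_iff_lt.2 this
    rw [e, e'] at this
    simp only [lt_iff_le_and_ne, le_def, le] at this
    grind
  · subst hj
    rw [e] at e'
    grind
  · have : up r j' h' < up r j h := by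
      simp only [lt_iff_le_and_ne, le_def, le]; grind
    have := σ.lt_iff_lt.2 this
    rw [e, e'] at this
    simp only [lt_iff_le_and_ne, le_def, le] at this
    grind

theorem aut_up_le (σ : BB X ≃o BB X) {r : Λ} {j : ℕ} {h} {s : Λ} {i : ℕ} {hi}
    (e : σ (up r j h) = up s i hi) : j ≤ i := by
  induction j generalizing s i with
  | zero => exact Nat.zero_le _
  | succ j ih =>
    obtain ⟨s', i', hi', e'⟩ := aut_up σ r j (by omega)
    have := ih e'
    have := (aut_up_same σ e' e).2 (by omega)
    omega

theorem aut_up' (σ : BB X ≃o BB X) (r : Λ) :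
    ∃ s, X.len r = X.len s ∧ ∀ j h, ∃ h', σ (up r j h) = up s j h' := by
  have key : ∀ (σ : BB X ≃o BB X) (r : Λ),
      ∃ s, X.len r ≤ X.len s ∧ ∀ j h, ∃ h', σ (up r j h) = up s j h' := by
    intro σ r
    have h3 := X.three_le r
    obtain ⟨s, i, hi, e⟩ := aut_up σ r 0 (by omega)
    have hh : ∀ j h, ∃ h', σ (up r j h) = up s j h' := by
      intro j h
      obtain ⟨s', i', hi', e'⟩ := aut_up σ r j h
      have e2 : σ.symm (up s' i' hi') = up r j h := by rw [← e']; simp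
      have a1 := aut_up_le σ e'
      have a2 := aut_up_le σ.symm e2
      have a3 := (aut_up_same σ e e').1
      obtain rfl : i' = j := le_antisymm a2 a1
      subst a3
      exact ⟨hi', e'⟩
    refine ⟨s, ?_, hh⟩
    obtain ⟨h', -⟩ := hh (X.len r - 1) (by omega)
    omega
  obtain ⟨s, h1, h2⟩ := key σ r
  obtain ⟨r', h1', h2'⟩ := key σ.symm s
  refine ⟨s, le_antisymm h1 ?_, h2⟩
  have h3 := X.three_le r
  obtain ⟨h, e⟩ := h2 0 (by omega)
  obtain ⟨h', e'⟩ := h2' 0 h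
  rw [← e] at e'
  simp at e'
  rw [e']
  exact h1'

def conj (σ : BB X ≃o BB X) : BB X ≃o BB X where
  toFun a := D (σ (D a))
  invFun a := D (σ.symm (D a))
  left_inv a := by simp
  right_inv a := by simp
  map_rel_iff' := by
    intro a b
    simp [D_le]

theorem aut_inc {σ : BB X ≃o BB X} {r s : Λ} {x y : X.Pt}
    (hx : ∀ k, σ (pt x k) = pt y k)
    (hr : ∀ j h, ∃ h', σ (up r j h) = up s j h') (h : X.inc r x) : X.inc s y ∧ y.i ≤ x.i := by
  have h1 : pt x 0 ≤ up r x.i h.1 := by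
    rw [le_def]; exact ⟨rfl, h, le_rfl⟩
  have h2 := σ.le_iff_le.2 h1
  obtain ⟨h', e⟩ := hr x.i h.1
  rw [hx, e] at h2
  simp only [le_def, le] at h2
  exact h2.2

theorem aut_inc' {σ : BB X ≃o BB X} {r s : Λ} {x y : X.Pt}
    (hx : ∀ k, σ (pt x k) = pt y k)
    (hl : X.len r = X.len s)
    (hr : ∀ j h, ∃ h', σ (up r j h) = up s j h') (h : X.inc r x) : X.inc s y ∧ y.i = x.i := by
  have a := aut_inc hx hr h
  refine ⟨a.1, le_antisymm a.2 ?_⟩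
  refine (aut_inc (σ := σ.symm) (r := s) (s := r) (x := y) (y := x) ?_ ?_ a.1).2
  · intro k; rw [← hx]; simp
  · intro j h
    obtain ⟨h', e⟩ := hr j (hl ▸ h)
    exact ⟨hl ▸ h, by rw [← e]; simp⟩

theorem aut_dn (σ : BB X ≃o BB X) (r s : Λ) (hl : X.len r = X.len s)
    (hr : ∀ j h, ∃ h', σ (up r j h) = up s j h') : ∀ j h, ∃ h', σ (dn r j h) = dn s j h' := by
  obtain ⟨s', hl', h'⟩ := aut_up' (conj σ) r
  have hs : s = s' := by
    have h3 := X.three_le r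
    have hxy : X.p r 0 (by omega) ≠ X.p r 1 (by omega) := by simp [p]
    have i1 := X.inc_p r 0 (by omega)
    have i2 := X.inc_p r 1 (by omega)
    generalize X.p r 0 (by omega) = x at *
    generalize X.p r 1 (by omega) = y at *
    have cj : ∀ x z, (∀ k, σ (pt x k) = pt z k) → ∀ k, conj σ (pt x k) = pt z k := by
      intro x z h k
      show D (σ (D (pt x k))) = _
      simp [D, h]
    obtain ⟨x', hx'⟩ := aut_pt σ x
    obtain ⟨y', hy'⟩ := aut_pt σ y
    have hxy' : x' ≠ y' := by
      rintro rfl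
      have := hx' 0
      rw [← hy' 0] at this
      simp [hxy] at this
    exact inc_eq hxy' (aut_inc' hx' hl hr i1).1 (aut_inc' hy' hl hr i2).1
      (aut_inc' (cj _ _ hx') hl' h' i1).1 (aut_inc' (cj _ _ hy') hl' h' i2).1
  subst hs
  intro j h
  obtain ⟨k, e⟩ := h' j h
  refine ⟨k, ?_⟩
  have : D (σ (D (up r j h))) = up s j k := e
  rw [← D_D (σ (dn r j h))]
  exact congrArg D this

/-- An automorphism of `BB` induces a permutation of lines. -/
theorem aut_main (σ : BB X ≃o BB X) : ∃ (ρ : Λ → Λ) (τ : X.Pt → X.Pt),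
    (∀ x k, σ (pt x k) = pt (τ x) k) ∧
    (∀ r j h, ∃ h', σ (up r j h) = up (ρ r) j h') ∧
    (∀ r j h, ∃ h', σ (dn r j h) = dn (ρ r) j h') ∧
    (∀ r, X.len r = X.len (ρ r)) ∧
    (∀ r x, X.inc r x → X.inc (ρ r) (τ x) ∧ (τ x).i = x.i) := by
  choose ρ hρ hρ' using aut_up' σ
  choose τ hτ using aut_pt σ
  exact ⟨ρ, τ, hτ, hρ', fun r => aut_dn σ r _ (hρ r) (hρ' r), hρ,
    fun r x h => aut_inc' (hτ x) (hρ r) (hρ' r) h⟩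

end BB
end Geo
/-! ### Gluing chains over a base lattice -/

structure Fib (B : Type w) [Lattice B] where
  n : B → ℕ
  f : B → B → ℕ → ℕ
  g : B → B → ℕ → ℕ
  f_le : ∀ b b' k, b ≤ b' → k ≤ n b → f b b' k ≤ n b'
  g_le : ∀ b b' l, b ≤ b' → l ≤ n b' → g b b' l ≤ n b
  gc : ∀ b b' k l, b ≤ b' → k ≤ n b → l ≤ n b' → (f b b' k ≤ l ↔ k ≤ g b b' l)
  f_id : ∀ b k, k ≤ n b → f b b k = k
  f_comp : ∀ b b' b'' k, b ≤ b' → b' ≤ b'' → k ≤ n b → f b' b'' (f b b' k) = f b b'' k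

namespace Fib

variable {B : Type w} [Lattice B] (F : Fib B)

theorem f_mono {b b' : B} {k k' : ℕ} (h : b ≤ b') (hk' : k' ≤ F.n b) (hkk : k ≤ k') :
    F.f b b' k ≤ F.f b b' k' := by
  rw [F.gc _ _ _ _ h (hkk.trans hk') (F.f_le _ _ _ h hk')]
  exact hkk.trans ((F.gc _ _ _ _ h hk' (F.f_le _ _ _ h hk')).1 le_rfl)

theorem g_mono {b b' : B} {k k' : ℕ} (h : b ≤ b') (hk' : k' ≤ F.n b') (hkk : k ≤ k') :
    F.g b b' k ≤ F.g b b' k' := by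
  rw [← F.gc _ _ _ _ h (F.g_le _ _ _ h (hkk.trans hk')) hk']
  exact ((F.gc _ _ _ _ h (F.g_le _ _ _ h (hkk.trans hk')) (hkk.trans hk')).2 le_rfl).trans hkk

theorem f_zero {b b' : B} (h : b ≤ b') : F.f b b' 0 = 0 :=
  Nat.le_zero.1 ((F.gc _ _ _ _ h (Nat.zero_le _) (Nat.zero_le _)).2 (Nat.zero_le _))

theorem g_top {b b' : B} (h : b ≤ b') : F.g b b' (F.n b') = F.n b :=
  le_antisymm (F.g_le _ _ _ h le_rfl)
    ((F.gc _ _ _ _ h le_rfl le_rfl).1 (F.f_le _ _ _ h le_rfl))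

theorem g_id {b : B} {k : ℕ} (h : k ≤ F.n b) : F.g b b k = k := by
  apply le_antisymm
  · have := (F.gc b b (F.g b b k) k le_rfl (F.g_le _ _ _ le_rfl h) h).2 le_rfl
    rwa [F.f_id _ _ (F.g_le _ _ _ le_rfl h)] at this
  · exact (F.gc b b k k le_rfl h h).1 (F.f_id _ _ h).le

@[ext]
structure Tot (F : Fib B) where
  b : B
  k : ℕ
  h : k ≤ F.n b

namespace Tot

variable {F}

instance : PartialOrder (Tot F) where
  le u v := u.b ≤ v.b ∧ F.f u.b v.b u.k ≤ v.k
  le_refl u := ⟨le_rfl, (F.f_id _ _ u.h).le⟩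
  le_trans u v t h1 h2 := ⟨h1.1.trans h2.1, by
    rw [← F.f_comp u.b v.b t.b u.k h1.1 h2.1 u.h]
    exact (F.f_mono h2.1 v.h h1.2).trans h2.2⟩
  le_antisymm u v h1 h2 := by
    have hb := le_antisymm h1.1 h2.1
    obtain ⟨b, k, h⟩ := u
    obtain ⟨b', k', h'⟩ := v
    simp only at hb
    subst hb
    have e1 := h1.2
    have e2 := h2.2
    simp only at e1 e2
    rw [F.f_id _ _ (by assumption)] at e1 e2
    congr
    exact le_antisymm e1 e2

theorem le_def (u v : Tot F) : u ≤ v ↔ u.b ≤ v.b ∧ F.f u.b v.b u.k ≤ v.k := Iff.rfl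

theorem le_def' (u v : Tot F) : u ≤ v ↔ u.b ≤ v.b ∧ u.k ≤ F.g u.b v.b v.k := by
  rw [le_def]
  exact and_congr_right fun h => F.gc _ _ _ _ h u.h v.h

instance : Lattice (Tot F) where
  sup u v := ⟨u.b ⊔ v.b, max (F.f u.b (u.b ⊔ v.b) u.k) (F.f v.b (u.b ⊔ v.b) v.k),
    max_le (F.f_le _ _ _ le_sup_left u.h) (F.f_le _ _ _ le_sup_right v.h)⟩
  inf u v := ⟨u.b ⊓ v.b, min (F.g (u.b ⊓ v.b) u.b u.k) (F.g (u.b ⊓ v.b) v.b v.k),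
    (min_le_left _ _).trans (F.g_le _ _ _ inf_le_left u.h)⟩
  le_sup_left u v := ⟨le_sup_left, le_max_left _ _⟩
  le_sup_right u v := ⟨le_sup_right, le_max_right _ _⟩
  sup_le u v t h1 h2 := by
    refine ⟨sup_le h1.1 h2.1, ?_⟩
    simp only
    rcases max_choice (F.f u.b (u.b ⊔ v.b) u.k) (F.f v.b (u.b ⊔ v.b) v.k) with h | h <;> rw [h]
    · rw [F.f_comp _ _ _ _ le_sup_left (sup_le h1.1 h2.1) u.h]; exact h1.2
    · rw [F.f_comp _ _ _ _ le_sup_right (sup_le h1.1 h2.1) v.h]; exact h2.2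
  inf_le_left u v := by rw [le_def']; exact ⟨inf_le_left, min_le_left _ _⟩
  inf_le_right u v := by rw [le_def']; exact ⟨inf_le_right, min_le_right _ _⟩
  le_inf u v t h1 h2 := by
    have hb : u.b ≤ v.b ⊓ t.b := le_inf h1.1 h2.1
    refine ⟨hb, ?_⟩
    apply le_min
    · rw [← F.gc _ _ _ _ inf_le_left (F.f_le _ _ _ hb u.h) v.h,
        F.f_comp _ _ _ _ hb inf_le_left u.h]
      exact h1.2
    · rw [← F.gc _ _ _ _ inf_le_right (F.f_le _ _ _ hb u.h) t.h,
        F.f_comp _ _ _ _ hb inf_le_right u.h]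
      exact h2.2

theorem sup_def (u v : Tot F) : u ⊔ v =
    ⟨u.b ⊔ v.b, max (F.f u.b (u.b ⊔ v.b) u.k) (F.f v.b (u.b ⊔ v.b) v.k),
    max_le (F.f_le _ _ _ le_sup_left u.h) (F.f_le _ _ _ le_sup_right v.h)⟩ := rfl

theorem inf_def (u v : Tot F) : u ⊓ v =
   ⟨u.b ⊓ v.b, min (F.g (u.b ⊓ v.b) u.b u.k) (F.g (u.b ⊓ v.b) v.b v.k),
    (min_le_left _ _).trans (F.g_le _ _ _ inf_le_left u.h)⟩ := rfl

theorem sup_b (u v : Tot F) : (u ⊔ v).b = u.b ⊔ v.b := rfl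
theorem inf_b (u v : Tot F) : (u ⊓ v).b = u.b ⊓ v.b := rfl

/-- A family of fibrewise congruences gives a congruence. -/
def famCon (R : B → ℕ → ℕ → Prop) (refl : ∀ b k, R b k k) (symm : ∀ b k l, R b k l → R b l k)
    (trans : ∀ b k l m, R b k l → R b l m → R b k m)
    (hmax : ∀ b k l k' l', R b k l → R b k' l' → R b (max k k') (max l l'))
    (hmin : ∀ b k l k' l', R b k l → R b k' l' → R b (min k k') (min l l'))
    (hf : ∀ b b' k l, b ≤ b' → k ≤ F.n b → l ≤ F.n b → R b k l → R b' (F.f b b' k) (F.f b b' l))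
    (hg : ∀ b b' k l, b ≤ b' → k ≤ F.n b' → l ≤ F.n b' → R b' k l → R b (F.g b b' k) (F.g b b' l)) :
    LatCon (Tot F) where
  rel u v := u.b = v.b ∧ R u.b u.k v.k
  refl u := ⟨rfl, refl _ _⟩
  symm := fun {u v} h => ⟨h.1.symm, h.1 ▸ symm _ _ _ h.2⟩
  trans := fun {u v t} h1 h2 => ⟨h1.1.trans h2.1, trans _ _ _ _ h1.2 (h1.1 ▸ h2.2)⟩
  sup := by
    rintro ⟨b, k, hk⟩ ⟨b', k', hk'⟩ ⟨c, l, hl⟩ ⟨c', l', hl'⟩ ⟨h1, h2⟩ ⟨h3, h4⟩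
    simp only at h1 h2 h3 h4
    subst h1 h3
    exact ⟨rfl, hmax _ _ _ _ _ (hf _ _ _ _ le_sup_left hk hk' h2)
      (hf _ _ _ _ le_sup_right hl hl' h4)⟩
  inf := by
    rintro ⟨b, k, hk⟩ ⟨b', k', hk'⟩ ⟨c, l, hl⟩ ⟨c', l', hl'⟩ ⟨h1, h2⟩ ⟨h3, h4⟩
    simp only at h1 h2 h3 h4
    subst h1 h3
    exact ⟨rfl, hmin _ _ _ _ _ (hg _ _ _ _ inf_le_left hk hk' h2)
      (hg _ _ _ _ inf_le_right hl hl' h4)⟩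

def kerCon (F : Fib B) : LatCon (Tot F) where
  rel u v := u.b = v.b
  refl _ := rfl
  symm := fun h => h.symm
  trans := fun h1 h2 => h1.trans h2
  sup := fun h1 h2 => by rw [sup_b, sup_b, h1, h2]
  inf := fun h1 h2 => by rw [inf_b, inf_b, h1, h2]

/-- The relation induced by a congruence on a fibre. -/
def fr (θ : LatCon (Tot F)) (b : B) (k l : ℕ) : Prop :=
  ∃ (hk : k ≤ F.n b) (hl : l ≤ F.n b), θ.rel ⟨b, k, hk⟩ ⟨b, l, hl⟩

theorem fr_symm {θ : LatCon (Tot F)} {b : B} {k l : ℕ} (h : fr θ b k l) : fr θ b l k :=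
  ⟨h.2.1, h.1, θ.symm h.2.2⟩

theorem fr_f {θ : LatCon (Tot F)} {b b' : B} {k l : ℕ} (hb : b ≤ b') (h : fr θ b k l) :
    fr θ b' (F.f b b' k) (F.f b b' l) := by
  obtain ⟨hk, hl, h⟩ := h
  refine ⟨F.f_le _ _ _ hb hk, F.f_le _ _ _ hb hl, ?_⟩
  have := θ.sup h (θ.refl ⟨b', 0, Nat.zero_le _⟩)
  have e : b ⊔ b' = b' := sup_eq_right.2 hb
  have key : ∀ k hk, ((⟨b, k, hk⟩ : Tot F) ⊔ ⟨b', 0, Nat.zero_le _⟩) =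
      ⟨b', F.f b b' k, F.f_le _ _ _ hb hk⟩ := by
    intro k hk
    ext
    · exact e
    · simp only [sup_def, e, F.f_zero le_rfl]; simp
  rwa [key, key] at this

theorem fr_g {θ : LatCon (Tot F)} {b b' : B} {k l : ℕ} (hb : b ≤ b') (h : fr θ b' k l) :
    fr θ b (F.g b b' k) (F.g b b' l) := by
  obtain ⟨hk, hl, h⟩ := h
  refine ⟨F.g_le _ _ _ hb hk, F.g_le _ _ _ hb hl, ?_⟩
  have := θ.inf h (θ.refl ⟨b, F.n b, le_rfl⟩)
  have e : b' ⊓ b = b := inf_eq_right.2 hb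
  have key : ∀ k hk, ((⟨b', k, hk⟩ : Tot F) ⊓ ⟨b, F.n b, le_rfl⟩) =
      ⟨b, F.g b b' k, F.g_le _ _ _ hb hk⟩ := by
    intro k hk
    ext
    · exact e
    · simp only [inf_def, e, F.g_id le_rfl]; simp [F.g_le _ _ _ hb hk]
  rwa [key, key] at this

theorem mk_le {b : B} {k l : ℕ} {hk : k ≤ F.n b} {hl : l ≤ F.n b} :
    (⟨b, k, hk⟩ : Tot F) ≤ ⟨b, l, hl⟩ ↔ k ≤ l := by
  simp [le_def, F.f_id _ _ hk]

theorem fr_convex {θ : LatCon (Tot F)} {b : B} {k l k' l' : ℕ} (h : fr θ b k l)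
    (h1 : k ≤ k') (h2 : k' ≤ l') (h3 : l' ≤ l) : fr θ b k' l' := by
  obtain ⟨hk, hl, h⟩ := h
  have hl' := h3.trans hl
  have hk' := h2.trans hl'
  refine ⟨hk', hl', ?_⟩
  have a := θ.inf h (θ.refl ⟨b, l', hl'⟩)
  rw [inf_eq_left.2 (mk_le.2 (h1.trans h2)), inf_eq_right.2 (mk_le.2 h3)] at a
  have b' := θ.sup a (θ.refl ⟨b, k', hk'⟩)
  rwa [sup_eq_right.2 (mk_le.2 h1), sup_eq_left.2 (mk_le.2 h2)] at b'

end Tot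
end Fib
/-! ### The fibred lattice over `BB X` -/

structure Wt {Λ Y : Type w} (X : Geo Λ Y) where
  nP : X.Pt → ℕ
  nL : Λ → ℕ
  c : Λ → ℕ → ℕ
  c_pos : ∀ r i, 0 < c r i
  cond : ∀ r x, X.inc r x → c r x.i * nP x ≤ nL r

namespace Wt

open Geo Geo.BB

variable {Λ Y : Type w} {X : Geo Λ Y} (W : Wt X)

def n : BB X → ℕ
  | .bot => 0
  | .top => 0
  | .pt x _ => W.nP x
  | .up r _ _ => W.nL r
  | .dn r _ _ => W.nL r

def f : BB X → BB X → ℕ → ℕ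
  | .pt _ _, .pt _ _, k => k
  | .up _ _ _, .up _ _ _, k => k
  | .dn _ _ _, .dn _ _ _, k => k
  | .pt x _, .up r _ _, k => W.c r x.i * k
  | .dn r _ _, .pt x _, l => W.nP x - (W.nL r - l) / W.c r x.i
  | _, _, _ => 0

def g : BB X → BB X → ℕ → ℕ
  | .pt _ _, .pt _ _, k => k
  | .up _ _ _, .up _ _ _, k => k
  | .dn _ _ _, .dn _ _ _, k => k
  | .pt x _, .up r _ _, l => min (W.nP x) (l / W.c r x.i)
  | .dn r _ _, .pt x _, k => W.nL r - W.c r x.i * (W.nP x - k)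
  | .pt x _, .top, _ => W.nP x
  | .up r _ _, .top, _ => W.nL r
  | .dn r _ _, .top, _ => W.nL r
  | _, _, _ => 0

theorem f_bound (b b' k) (h : b ≤ b') (hk : k ≤ W.n b) : W.f b b' k ≤ W.n b' := by
  rw [le_def] at h
  cases b <;> cases b' <;> simp only [le, f, n] at * <;> try grind
  · exact (Nat.mul_le_mul_left _ hk).trans (W.cond _ _ h.2.1)

theorem g_bound (b b' l) (h : b ≤ b') (hk : l ≤ W.n b') : W.g b b' l ≤ W.n b := by
  rw [le_def] at h
  cases b <;> cases b' <;> simp only [le, g, n] at * <;> grind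

theorem gc_aux (N M c k l : ℕ) (hc : 0 < c) (h : c * N ≤ M) (hk : k ≤ N) (hl : l ≤ M) :
    N - (M - l) / c ≤ k ↔ l ≤ M - c * (N - k) := by
  have h1 : N - (M - l) / c ≤ k ↔ N - k ≤ (M - l) / c := by omega
  rw [h1, Nat.le_div_iff_mul_le hc, mul_comm]
  have : c * (N - k) ≤ M := (Nat.mul_le_mul_left _ (Nat.sub_le _ _)).trans h
  omega

theorem gc' (b b' k l) (h : b ≤ b') (hk : k ≤ W.n b) (hl : l ≤ W.n b') :
    W.f b b' k ≤ l ↔ k ≤ W.g b b' l := by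
  rw [le_def] at h
  cases b <;> cases b' <;> simp only [le, f, g, n] at * <;> try grind
  · rw [le_min_iff, Nat.le_div_iff_mul_le (W.c_pos _ _), mul_comm]
    tauto
  · exact gc_aux _ _ _ _ _ (W.c_pos _ _) (W.cond _ _ h.2.1) hl hk

theorem f_id' (b k) (hk : k ≤ W.n b) : W.f b b k = k := by
  cases b <;> simp only [f, n] at * <;> omega

theorem f_comp' (b b' b'' k) (h : b ≤ b') (h' : b' ≤ b'') (hk : k ≤ W.n b) :
    W.f b' b'' (W.f b b' k) = W.f b b'' k := by
  rw [le_def] at h h'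
  have key : ∀ r x, X.inc r x → W.nP x - (W.nL r - 0) / W.c r x.i = 0 := by
    intro r x hx
    have := (Nat.le_div_iff_mul_le (W.c_pos r x.i)).2 ((mul_comm _ _).trans_le (W.cond r x hx))
    rw [Nat.sub_zero]
    omega
  cases b <;> cases b' <;> cases b'' <;> simp only [le, f, n] at * <;> grind

def F : Fib (BB X) where
  n := W.n
  f := W.f
  g := W.g
  f_le := W.f_bound
  g_le := W.g_bound
  gc := W.gc'
  f_id := W.f_id'
  f_comp := W.f_comp'

abbrev L := Fib.Tot W.F

/-! #### Selfduality -/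

theorem n_D (b : BB X) : W.n (BB.D b) = W.n b := by cases b <;> rfl

theorem f_D (b b' k l) (h : b ≤ b') (hk : k ≤ W.n b) (hl : l ≤ W.n b') :
    W.f b b' k ≤ l ↔ W.f (BB.D b') (BB.D b) (W.n b' - l) ≤ W.n b - k := by
  rw [le_def] at h
  cases b <;> cases b' <;> simp only [le, f, n, BB.D] at * <;> try grind
  · rename_i x _ r _ _
    have e : W.nL r - (W.nL r - l) = l := by omega
    rw [e]
    have : W.nP x - l / W.c r x.i ≤ W.nP x - k ↔ k ≤ l / W.c r x.i := by omega
    rw [this, Nat.le_div_iff_mul_le (W.c_pos _ _), mul_comm]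
  · rename_i r _ _ x _
    rw [gc_aux _ _ _ _ _ (W.c_pos _ _) (W.cond _ _ h.2.1) hl hk]
    have : W.c r x.i * (W.nP x - l) ≤ W.nL r := 
      (Nat.mul_le_mul_left _ (Nat.sub_le _ _)).trans (W.cond _ _ h.2.1)
    omega

def dual (u : W.L) : W.L := ⟨BB.D u.b, W.n u.b - u.k, by
  change _ ≤ W.n _
  rw [n_D]; omega⟩

theorem dual_dual (u : W.L) : W.dual (W.dual u) = u := by
  ext
  · simp [dual]
  · have := u.h
    change u.k ≤ W.n _ at this
    simp only [dual, n_D]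
    omega

theorem dual_le (u v : W.L) : W.dual v ≤ W.dual u ↔ u ≤ v := by
  rw [Fib.Tot.le_def, Fib.Tot.le_def]
  simp only [dual, D_le]
  exact and_congr_right fun h => (W.f_D _ _ _ _ h u.h v.h).symm

def dualIso : W.L ≃o W.Lᵒᵈ where
  toFun u := OrderDual.toDual (W.dual u)
  invFun u := W.dual (OrderDual.ofDual u)
  left_inv := W.dual_dual
  right_inv := W.dual_dual
  map_rel_iff' := fun {u v} => W.dual_le u v

end Wt
namespace Wt

open Geo Geo.BB

variable {Λ Y : Type w} {X : Geo Λ Y} (W : Wt X)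

def T : W.L := ⟨⊤, 0, Nat.zero_le _⟩
def O : W.L := ⟨⊥, 0, Nat.zero_le _⟩
def M (x : X.Pt) : W.L := ⟨BB.pt x 1, 0, Nat.zero_le _⟩

variable {W}

theorem eq_T {u : W.L} (h : u.b = ⊤) : u = W.T := by
  obtain ⟨b, k, hk⟩ := u
  simp only at h
  subst h
  ext
  · rfl
  · exact Nat.le_zero.1 hk

theorem eq_O {u : W.L} (h : u.b = ⊥) : u = W.O := by
  obtain ⟨b, k, hk⟩ := u
  simp only at h
  subst h
  ext
  · rfl
  · exact Nat.le_zero.1 hk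

theorem le_T (u : W.L) : u ≤ W.T := by
  refine ⟨le_top, ?_⟩
  change W.f u.b BB.top _ ≤ 0
  cases u.b <;> simp [f]

theorem O_le (u : W.L) : W.O ≤ u := by
  refine ⟨bot_le, ?_⟩
  exact (W.F.f_zero bot_le).le.trans (Nat.zero_le _)

variable {θ : LatCon W.L}

theorem full_of_OT (h : θ.rel W.O W.T) (s t : W.L) : θ.rel s t := by
  have key : ∀ s, θ.rel W.O s := by
    intro s
    have := θ.inf (θ.refl s) h
    rwa [inf_eq_right.2 (O_le s), inf_eq_left.2 (le_T s)] at this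
  exact θ.trans (θ.symm (key s)) (key t)

theorem MM_inf {x y : X.Pt} (h : y ≠ x) : W.M y ⊓ W.M x = W.O := by
  apply eq_O
  rw [Fib.Tot.inf_b]
  apply mid_inf
  simp only [M, le_def, le]
  tauto

theorem MM_sup {x y : X.Pt} (h : y ≠ x) : W.M y ⊔ W.M x = W.T := by
  apply eq_T
  rw [Fib.Tot.sup_b]
  apply mid_sup
  simp only [M, le_def, le]
  tauto

theorem two_pts (hΛ : Nonempty Λ) (x : X.Pt) : ∃ y z : X.Pt, y ≠ x ∧ z ≠ x ∧ y ≠ z := by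
  obtain ⟨r⟩ := hΛ
  have h3 := X.three_le r
  have h0 : 0 < X.len r := by omega
  have h1 : 1 < X.len r := by omega
  have h2 : 2 < X.len r := by omega
  have e : ∀ i j hi hj, i ≠ j → X.p r i hi ≠ X.p r j hj := by
    intro i j hi hj hij h
    exact hij (congrArg Pt.i h)
  by_cases a : X.p r 0 h0 = x
  · refine ⟨X.p r 1 h1, X.p r 2 h2, ?_, ?_, ?_⟩
    · rw [← a]; apply e; omega
    · rw [← a]; apply e; omega
    · apply e; omega
  · by_cases b : X.p r 1 h1 = x
    · refine ⟨X.p r 0 h0, X.p r 2 h2, a, ?_, ?_⟩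
      · rw [← b]; apply e; omega
      · apply e; omega
    · exact ⟨_, _, a, b, e _ _ _ _ (by omega)⟩

theorem OT_of_O (hΛ : Nonempty Λ) {u : W.L} (hu : u.b ≠ ⊥) (h : θ.rel u W.O) :
    θ.rel W.O W.T := by
  obtain ⟨x, hx⟩ := exists_not_le hu hΛ
  have h1 : θ.rel W.T (W.M x) := by
    have := θ.sup (θ.refl (W.M x)) h
    rwa [sup_eq_left.2 (O_le _), eq_T (u := W.M x ⊔ u) (mid_sup hx)] at this
  have h2 : ∀ y, y ≠ x → θ.rel (W.M y) W.O := by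
    intro y hy
    have := θ.inf (θ.refl (W.M y)) h1
    rwa [inf_eq_left.2 (le_T _), MM_inf hy] at this
  obtain ⟨y, z, hy, hz, hyz⟩ := two_pts hΛ x
  have := θ.sup (h2 y hy) (h2 z hz)
  rw [MM_sup hyz, sup_idem] at this
  exact θ.symm this

theorem OT_of_T (hΛ : Nonempty Λ) {u : W.L} (hu : u.b ≠ ⊤) (h : θ.rel u W.T) :
    θ.rel W.O W.T := by
  obtain ⟨x, hx⟩ := exists_not_ge hu hΛ
  have := θ.inf (θ.refl (W.M x)) h
  rw [inf_eq_left.2 (le_T _), eq_O (u := W.M x ⊓ u) (mid_inf hx)] at this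
  exact OT_of_O hΛ (u := W.M x) (by simp [M, bot_def]) (θ.symm this)

theorem OT_of_lt (hΛ : Nonempty Λ) {u v : W.L} (huv : u.b < v.b) (h : θ.rel u v) :
    θ.rel W.O W.T := by
  rcases sep huv with ⟨w, h1, h2⟩ | ⟨w, h1, h2⟩
  · have := θ.sup h (θ.refl ⟨w, 0, Nat.zero_le _⟩)
    rw [eq_T (u := v ⊔ _) h2] at this
    exact OT_of_T hΛ (u := u ⊔ ⟨w, 0, Nat.zero_le _⟩) h1 this
  · have := θ.inf h (θ.refl ⟨w, 0, Nat.zero_le _⟩)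
    rw [eq_O (u := u ⊓ _) h1] at this
    exact OT_of_O hΛ (u := v ⊓ ⟨w, 0, Nat.zero_le _⟩) h2 (θ.symm this)

theorem OT_of_ne (hΛ : Nonempty Λ) {u v : W.L} (huv : u.b ≠ v.b) (h : θ.rel u v) :
    θ.rel W.O W.T := by
  have h1 := θ.inf (θ.refl u) h
  have h2 := θ.inf h (θ.refl v)
  rw [inf_idem] at h1 h2
  by_cases e : u.b ≤ v.b
  · exact OT_of_lt hΛ (lt_of_le_of_ne e huv) h
  · refine OT_of_lt hΛ (u := u ⊓ v) (v := u) ?_ (θ.symm h1)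
    rw [Fib.Tot.inf_b]
    exact inf_lt_left.2 e

theorem full_of_ne (hΛ : Nonempty Λ) {u v : W.L} (huv : u.b ≠ v.b) (h : θ.rel u v) (s t : W.L) :
    θ.rel s t := full_of_OT (OT_of_ne hΛ huv h) s t

theorem b_eq_iff (hΛ : Nonempty Λ) (u v : W.L) :
    u.b = v.b ↔ ∃ θ : LatCon W.L, θ.rel u v ∧ ∃ s t, ¬ θ.rel s t := by
  constructor
  · intro h
    exact ⟨Fib.Tot.kerCon W.F, h, W.O, W.T, by simp [Fib.Tot.kerCon, O, T, bot_def, top_def]⟩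
  · rintro ⟨θ, h, s, t, hst⟩
    by_contra hne
    exact hst (full_of_ne hΛ hne h s t)

/-! #### Automorphisms induce automorphisms of the base -/

def LatCon.comap' {A : Type w} [Lattice A] (θ : LatCon A) (σ : A ≃o A) : LatCon A where
  rel x y := θ.rel (σ x) (σ y)
  refl x := θ.refl _
  symm := fun h => θ.symm h
  trans := fun h1 h2 => θ.trans h1 h2
  sup := fun h1 h2 => by rw [map_sup, map_sup]; exact θ.sup h1 h2
  inf := fun h1 h2 => by rw [map_inf, map_inf]; exact θ.inf h1 h2

theorem aut_b (hΛ : Nonempty Λ) (σ : W.L ≃o W.L) {u v : W.L} (h : u.b = v.b) :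
    (σ u).b = (σ v).b := by
  obtain ⟨θ, h1, s, t, hst⟩ := (b_eq_iff hΛ u v).1 h
  rw [b_eq_iff hΛ]
  refine ⟨LatCon.comap' θ σ.symm, ?_, σ s, σ t, ?_⟩
  · simpa [LatCon.comap'] using h1
  · simpa [LatCon.comap'] using hst

variable (W) in
def z (b : BB X) : W.L := ⟨b, 0, Nat.zero_le _⟩

theorem z_le {a b : BB X} : W.z a ≤ W.z b ↔ a ≤ b := by
  rw [Fib.Tot.le_def]
  constructor
  · exact fun h => h.1
  · intro h
    exact ⟨h, (W.F.f_zero h).le⟩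

theorem base_mono (hΛ : Nonempty Λ) (σ : W.L ≃o W.L) {a b : BB X} (h : a ≤ b) :
    (σ (W.z a)).b ≤ (σ (W.z b)).b := by
  have : σ (W.z a) ≤ σ (W.z b) := σ.monotone (z_le.2 h)
  exact this.1

theorem base_inv (hΛ : Nonempty Λ) (σ : W.L ≃o W.L) (a : BB X) :
    (σ.symm (W.z (σ (W.z a)).b)).b = a := by
  have h := aut_b hΛ σ.symm (u := W.z (σ (W.z a)).b) (v := σ (W.z a)) rfl
  rw [h]
  simp [z]

noncomputable def baseAut (hΛ : Nonempty Λ) (σ : W.L ≃o W.L) : BB X ≃o BB X where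
  toFun a := (σ (W.z a)).b
  invFun a := (σ.symm (W.z a)).b
  left_inv a := base_inv hΛ σ a
  right_inv a := base_inv hΛ σ.symm a
  map_rel_iff' := by
    intro a b
    refine ⟨fun h => ?_, fun h => base_mono hΛ σ h⟩
    have := base_mono hΛ σ.symm h
    change (σ.symm (W.z (σ (W.z a)).b)).b ≤ (σ.symm (W.z (σ (W.z b)).b)).b at this
    rwa [base_inv hΛ, base_inv hΛ] at this

theorem baseAut_b (hΛ : Nonempty Λ) (σ : W.L ≃o W.L) (u : W.L) :
    (σ u).b = baseAut hΛ σ u.b := aut_b hΛ σ rfl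

/-- An automorphism with trivial base map is trivial. -/
theorem aut_trivial (σ : W.L ≃o W.L) (h : ∀ u, (σ u).b = u.b) (u : W.L) : σ u = u := by
  have key : ∀ (σ : W.L ≃o W.L), (∀ u, (σ u).b = u.b) → ∀ m (u : W.L), u.k = m → m ≤ (σ u).k := by
    intro σ h m
    induction m with
    | zero => intros; omega
    | succ m ih =>
      intro u hu
      have hm : m ≤ W.F.n u.b := by have := u.h; omega
      have h1 := ih ⟨u.b, m, hm⟩ rfl
      have h2 : σ ⟨u.b, m, hm⟩ < σ u := by
        apply σ.strictMono
        rw [lt_iff_le_and_ne]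
        constructor
        · exact Fib.Tot.mk_le.2 (by omega)
        · intro e
          have := congrArg Fib.Tot.k e
          simp only at this
          omega
      have e1 := h ⟨u.b, m, hm⟩
      have e2 := h u
      revert h1 h2 e1 e2
      generalize σ ⟨u.b, m, hm⟩ = a
      generalize σ u = c
      obtain ⟨a, k, hk⟩ := a
      obtain ⟨c, l, hl⟩ := c
      intro h1 h2 e1 e2
      simp only at h1 e1 e2 ⊢
      subst e1
      subst e2
      have : k ≤ l := Fib.Tot.mk_le.1 h2.le
      have : k ≠ l := by
        rintro rfl
        exact lt_irrefl _ h2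
      omega
  have hs : ∀ u, (σ.symm u).b = u.b := by
    intro u
    have := h (σ.symm u)
    simpa using this.symm
  ext
  · exact h u
  · apply le_antisymm
    · simpa using key σ.symm hs _ (σ u) rfl
    · exact key σ h _ u rfl

end Wt
namespace Wt

open Geo Geo.BB

variable {Λ Y : Type w} {X : Geo Λ Y} {W : Wt X}

/-! #### Length -/

variable (W) in
def rk : BB X → ℕ → ℕ
  | .bot, _ => 0
  | .top, _ => 16
  | .pt _ ⟨0, _⟩, a => 1 + a
  | .pt _ ⟨1, _⟩, a => 7 + a
  | .pt x ⟨_ + 2, _⟩, a => 15 - (W.nP x - a)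
  | .up _ j _, a => 2 + j + a
  | .dn r j _, a => 14 - j - (W.nL r - a)

theorem rk_le (h1 : ∀ x, W.nP x ≤ 1) (h2 : ∀ r, X.len r + W.nL r ≤ 14) (b k) (hk : k ≤ W.n b) :
    rk W b k ≤ 16 := by
  cases b with
  | bot => simp [rk]
  | top => simp [rk]
  | pt x i =>
    have := h1 x
    simp only [n] at hk
    fin_cases i <;> simp [rk] <;> omega
  | up r j h =>
    have := h2 r
    simp only [n] at hk
    simp [rk]; omega
  | dn r j h => simp [rk]; omega

theorem rk_lt (h1 : ∀ x, W.nP x ≤ 1) (h2 : ∀ r, X.len r + W.nL r ≤ 14) (b b' k l)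
    (hk : k ≤ W.n b) (hl : l ≤ W.n b') (hb : b ≤ b') (hf : W.f b b' k ≤ l)
    (hne : b = b' → k ≠ l) : rk W b k < rk W b' l := by
  have hb' := hb
  rw [le_def] at hb
  cases b with
  | bot =>
    cases b' with
    | bot => simp only [n] at hk hl; simp at hne; omega
    | top => simp [rk]
    | pt x i =>
      have := h1 x
      fin_cases i <;> simp [rk] ; omega
    | up => simp [rk]
    | dn r j h =>
      have := h2 r
      simp [rk]; omega
  | top =>
    cases b' <;> simp only [le] at hb
    simp only [n] at hk hl; simp at hne; omega
  | pt x i =>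
    have hx := h1 x
    cases b' with
    | bot => simp [le] at hb
    | top =>
      simp only [n] at hk
      fin_cases i <;> simp [rk] <;> omega
    | pt y j =>
      simp only [le] at hb
      obtain ⟨rfl, hij⟩ := hb
      simp only [n] at hk hl
      simp only [f] at hf
      have : i = j → k ≠ l := by
        rintro rfl
        exact hne rfl
      clear hne hb'
      fin_cases i <;> fin_cases j <;> simp [rk] at * <;> omega
    | up r j h =>
      simp only [le] at hb
      obtain ⟨rfl, hi, hj⟩ := hb
      simp only [f] at hf
      have := Nat.le_mul_of_pos_left k (W.c_pos r x.i)
      change 1 + k < 2 + j + l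
      omega
    | dn => simp [le] at hb
  | up r i h =>
    have hx := h2 r
    cases b' <;> simp only [le] at hb
    · simp only [n] at hk
      simp [rk]; omega
    · obtain ⟨rfl, hij⟩ := hb
      simp only [f] at hf
      simp only [rk]
      rename_i j' _
      by_cases e : i = j'
      · subst e
        have := hne rfl
        omega
      · omega
  | dn r i h =>
    have hx := h2 r
    cases b' with
    | bot => simp [le] at hb
    | top => simp [rk]; omega
    | up => simp [le] at hb
    | pt x j =>
      simp only [le] at hb
      obtain ⟨rfl, hi, hj⟩ := hb
      have hx1 := h1 x
      simp only [f] at hf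
      simp only [n] at hk hl
      have := Nat.div_le_self (W.nL r - k) (W.c r x.i)
      change 14 - i - (W.nL r - k) < 15 - (W.nP x - l)
      omega
    | dn s j h' =>
      simp only [le] at hb
      obtain ⟨rfl, hij⟩ := hb
      simp only [f] at hf
      simp only [rk]
      simp only [n] at hk hl
      by_cases e : i = j
      · subst e
        have := hne rfl
        omega
      · omega

variable (X) in
def chn (r : Λ) (i : ℕ) : BB X :=
  if i = 0 then .bot else if i = 1 then .pt (X.p r 0 (by have := X.three_le r; omega)) 0 else
  if h : i - 2 < X.len r then .up r (i - 2) h else .top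

theorem chn_mono (r : Λ) (i j : ℕ) (h : i ≤ j) : chn X r i ≤ chn X r j := by
  rw [le_def]
  unfold chn
  split_ifs <;> simp only [le] <;> try omega
  · simp
  · exact ⟨trivial, inc_p _ _ _ _, Nat.zero_le _⟩
  · simp; omega

theorem rk_chn (r : Λ) (hr : X.len r = 14) (i : ℕ) (h : i ≤ 16) : rk W (chn X r i) 0 = i := by
  unfold chn
  split_ifs
  · simp [rk]; omega
  · simp [rk]; omega
  · simp [rk]; omega
  · simp [rk]; omega

theorem length16 (h1 : ∀ x, W.nP x ≤ 1) (h2 : ∀ r, X.len r + W.nL r ≤ 14)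
    (h3 : ∃ r, X.len r = 14) : LatLength W.L 16 := by
  constructor
  · obtain ⟨r, hr⟩ := h3
    refine ⟨(fun i => W.z (chn X r i)) '' (Set.Iic 16), ?_, (Set.finite_Iic 16).image _, ?_⟩
    · rintro _ ⟨i, -, rfl⟩ _ ⟨j, -, rfl⟩ -
      rcases le_total i j with h | h
      · left; exact z_le.2 (chn_mono r i j h)
      · right; exact z_le.2 (chn_mono r j i h)
    · rw [Set.InjOn.ncard_image]
      · rw [Set.ncard_eq_toFinset_card']; simp
      · intro i hi j hj hij
        have := congrArg (fun u : W.L => rk W u.b 0) hij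
        simp only [z] at this
        rwa [rk_chn r hr i hi, rk_chn r hr j hj] at this
  · intro C hC
    have inj : Set.InjOn (fun u : W.L => rk W u.b u.k) C := by
      intro u hu v hv huv
      by_contra hne
      have key : ∀ u v : W.L, u ≤ v → u ≠ v → rk W u.b u.k < rk W v.b v.k := by
        intro u v h hne
        refine rk_lt h1 h2 _ _ _ _ u.h v.h h.1 h.2 ?_
        intro e e'
        exact hne (by ext; exact e; exact e')
      simp only at huv
      rcases hC hu hv hne with h | h
      · exact absurd huv (key _ _ h hne).ne
      · exact absurd huv (key _ _ h (Ne.symm hne)).ne'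
    have hmaps : (fun u : W.L => rk W u.b u.k) '' C ⊆ Set.Iic 16 := by
      rintro _ ⟨u, -, rfl⟩
      exact rk_le h1 h2 _ _ u.h
    refine ⟨Set.Finite.of_finite_image ((Set.finite_Iic 16).subset hmaps) inj, ?_⟩
    rw [← Set.InjOn.ncard_image inj]
    refine (Set.ncard_le_ncard hmaps (Set.finite_Iic 16)).trans ?_
    rw [Set.ncard_eq_toFinset_card']; simp

end Wt
namespace Wt

open Geo Geo.BB

variable {Λ Y : Type w} {X : Geo Λ Y} {W : Wt X}

/-! #### Congruences given by weights -/

variable (W) in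
def R (mP : X.Pt → ℕ) (mL : Λ → ℕ) : BB X → ℕ → ℕ → Prop
  | .bot, k, l => k = l
  | .top, k, l => k = l
  | .pt x _, k, l => k = l ∨ W.nP x ≤ mP x
  | .up r _ _, k, l => k = l ∨ (k ≤ mL r ∧ l ≤ mL r)
  | .dn r _ _, k, l => k = l ∨ (W.nL r - mL r ≤ k ∧ W.nL r - mL r ≤ l)

noncomputable def cong (mP : X.Pt → ℕ) (mL : Λ → ℕ)
    (hP : ∀ x, mP x = 0 ∨ mP x = W.nP x)
    (hL : ∀ r x, X.inc r x → W.c r x.i * mP x ≤ mL r)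
    (hM : ∀ r x, X.inc r x → min (W.nP x) (mL r / W.c r x.i) ≤ mP x) : LatCon W.L :=
  Fib.Tot.famCon (R W mP mL)
    (by intro b k; cases b <;> simp [R])
    (by intro b k l; cases b <;> simp only [R] <;> grind)
    (by intro b k l; cases b <;> simp only [R] <;> grind)
    (by intro b k l; cases b <;> simp only [R] <;> grind)
    (by intro b k l; cases b <;> simp only [R] <;> grind)
    (by
      intro b b' k l hb hk hl h
      change k ≤ W.n b at hk
      change l ≤ W.n b at hl
      change R W mP mL b' (W.f b b' k) (W.f b b' l)
      rw [le_def] at hb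
      cases b <;> cases b' <;> simp only [R, f, n, le] at * <;> try grind
      · rename_i x _ r _ _
        rcases h with h | h
        · left; rw [h]
        · right
          have e := hL r x hb.2.1
          constructor
          · exact (Nat.mul_le_mul_left _ (hk.trans h)).trans e
          · exact (Nat.mul_le_mul_left _ (hl.trans h)).trans e
      · rename_i r _ _ x _
        rcases h with h | h
        · left; rw [h]
        · have e := hM r x hb.2.1
          have e1 : (W.nL r - k) / W.c r x.i ≤ mL r / W.c r x.i := Nat.div_le_div_right (by omega)
          have e2 : (W.nL r - l) / W.c r x.i ≤ mL r / W.c r x.i := Nat.div_le_div_right (by omega)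
          generalize mL r / W.c r x.i = C at *
          generalize (W.nL r - k) / W.c r x.i = A at *
          generalize (W.nL r - l) / W.c r x.i = B at *
          rcases hP x with h0 | h0
          · left; omega
          · right; omega)
    (by
      intro b b' k l hb hk hl h
      change k ≤ W.n b' at hk
      change l ≤ W.n b' at hl
      change R W mP mL b (W.g b b' k) (W.g b b' l)
      rw [le_def] at hb
      cases b <;> cases b' <;> simp only [R, g, n, le] at * <;> try grind
      · rename_i x _ r _ _
        rcases h with h | h
        · left; rw [h]
        · have e := hM r x hb.2.1
          have e1 : k / W.c r x.i ≤ mL r / W.c r x.i := Nat.div_le_div_right h.1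
          have e2 : l / W.c r x.i ≤ mL r / W.c r x.i := Nat.div_le_div_right h.2
          generalize mL r / W.c r x.i = C at *
          generalize k / W.c r x.i = A at *
          generalize l / W.c r x.i = B at *
          rcases hP x with h0 | h0
          · left; omega
          · right; omega
      · rename_i r _ _ x _
        rcases h with h | h
        · left; rw [h]
        · right
          have e := hL r x hb.2.1
          have e1 : W.c r x.i * (W.nP x - k) ≤ W.c r x.i * mP x := Nat.mul_le_mul_left _ (by omega)
          have e2 : W.c r x.i * (W.nP x - l) ≤ W.c r x.i * mP x := Nat.mul_le_mul_left _ (by omega)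
          omega)

open Fib.Tot

variable {θ : LatCon W.L}

theorem fr_pt {x : X.Pt} {i i' : Fin 3} {k l : ℕ} (h : fr θ (.pt x i) k l) :
    fr θ (.pt x i') k l := by
  rcases le_total i i' with e | e
  · exact fr_f (b := BB.pt x i) (b' := .pt x i') (by simp [le_def, le, e]) h
  · exact fr_g (b := BB.pt x i') (b' := .pt x i) (by simp [le_def, le, e]) h

theorem fr_up {r : Λ} {i i' : ℕ} {hi hi'} {k l : ℕ} (h : fr θ (.up r i hi) k l) :
    fr θ (.up r i' hi') k l := by
  rcases le_total i i' with e | e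
  · exact fr_f (b := BB.up r i hi) (b' := .up r i' hi') (by simp [le_def, le, e]) h
  · exact fr_g (b := BB.up r i' hi') (b' := .up r i hi) (by simp [le_def, le, e]) h

theorem fr_dn {r : Λ} {i i' : ℕ} {hi hi'} {k l : ℕ} (h : fr θ (.dn r i hi) k l) :
    fr θ (.dn r i' hi') k l := by
  rcases le_total i' i with e | e
  · exact fr_f (b := BB.dn r i hi) (b' := .dn r i' hi') (by simp [le_def, le, e]) h
  · exact fr_g (b := BB.dn r i' hi') (b' := .dn r i hi) (by simp [le_def, le, e]) h

variable (θ) in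
/-- The congruence collapses the cell at the point `x`. -/
def Hit (x : X.Pt) : Prop := fr θ (.pt x 0) 0 1

theorem Hit.up {r : Λ} {x : X.Pt} (h : Hit θ x) (hx : X.inc r x) (j hj) :
    fr θ (.up r j hj) 0 (W.c r x.i) := by
  have := fr_f (b := BB.pt x 0) (b' := .up r x.i hx.1) (by simp [le_def, le, hx]) h
  change fr θ _ (W.c r x.i * 0) (W.c r x.i * 1) at this
  rw [mul_zero, mul_one] at this
  exact fr_up this

theorem Hit.dn {r : Λ} {x : X.Pt} (h : Hit θ x) (h1 : W.nP x = 1) (hx : X.inc r x) (j hj) :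
    fr θ (.dn r j hj) (W.nL r - W.c r x.i) (W.nL r) := by
  have := fr_g (b := BB.dn r x.i hx.1) (b' := .pt x 2) (by simp [le_def, le, hx]) (fr_pt h)
  change fr θ _ (W.nL r - W.c r x.i * (W.nP x - 0)) (W.nL r - W.c r x.i * (W.nP x - 1)) at this
  rw [h1] at this
  simp only [Nat.sub_zero, Nat.sub_self, mul_zero, mul_one] at this
  exact fr_dn this

theorem hit_of_up {r : Λ} {x : X.Pt} {j hj k l} (h : fr θ (.up r j hj) k l) (h1 : W.nP x = 1)
    (hx : X.inc r x) (hk : k < W.c r x.i) (hl : W.c r x.i ≤ l) : Hit θ x := by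
  have := fr_g (b := BB.pt x 0) (b' := .up r x.i hx.1) (by simp [le_def, le, hx]) (fr_up h)
  change fr θ _ (min (W.nP x) (k / W.c r x.i)) (min (W.nP x) (l / W.c r x.i)) at this
  have e : 1 ≤ l / W.c r x.i := (Nat.le_div_iff_mul_le (W.c_pos r x.i)).2 (by simpa)
  rw [h1, Nat.div_eq_of_lt hk, min_eq_left e] at this
  exact this

theorem hit_of_dn {r : Λ} {x : X.Pt} {j hj k l} (h : fr θ (.dn r j hj) k l) (h1 : W.nP x = 1)
    (hx : X.inc r x) (hk : W.c r x.i ≤ W.nL r - k) (hl : W.nL r - l < W.c r x.i) : Hit θ x := by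
  have := fr_f (b := BB.dn r x.i hx.1) (b' := .pt x 2) (by simp [le_def, le, hx]) (fr_dn h)
  change fr θ _ (W.nP x - (W.nL r - k) / W.c r x.i) (W.nP x - (W.nL r - l) / W.c r x.i) at this
  have e : 1 ≤ (W.nL r - k) / W.c r x.i := (Nat.le_div_iff_mul_le (W.c_pos r x.i)).2 (by simpa)
  rw [h1, Nat.div_eq_of_lt hl, Nat.sub_eq_zero_of_le e] at this
  exact fr_pt this

theorem hit_trans {r : Λ} {x y : X.Pt} (h : Hit θ x) (hx : X.inc r x) (hy : X.inc r y)
    (h1 : W.nP y = 1) (hc : W.c r y.i ≤ W.c r x.i) : Hit θ y :=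
  hit_of_up (h.up hx x.i hx.1) h1 hy (W.c_pos _ _) hc

theorem fr_refl {b : BB X} {k : ℕ} (hk : k ≤ W.n b) : fr θ b k k := ⟨hk, hk, θ.refl _⟩

theorem cong_sub {mP : X.Pt → ℕ} {mL : Λ → ℕ} {hP hL hM} (h1 : ∀ x, W.nP x ≤ 1)
    (hc : ∀ r, mL r = 0 ∨ ∃ x, X.inc r x ∧ mP x = 1 ∧ W.nP x = 1 ∧ W.c r x.i = mL r)
    (hh : ∀ x, mP x = 1 → Hit θ x) {u v : W.L} (h : (cong (W := W) mP mL hP hL hM).rel u v) :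
    θ.rel u v := by
  have key : ∀ b k l, k ≤ l → k ≤ W.n b → l ≤ W.n b → R W mP mL b k l → fr θ b k l := by
    intro b k l hkl hk hl h
    cases b with
    | bot => simp only [R] at h; subst h; exact fr_refl hk
    | top => simp only [R] at h; subst h; exact fr_refl hk
    | pt x i =>
      simp only [R, n] at *
      rcases eq_or_ne k l with rfl | hne
      · exact fr_refl hk
      have := h1 x
      have e0 : k = 0 := by omega
      have e1 : l = 1 := by omega
      have e2 : mP x = 1 := by rcases hP x <;> omega
      subst e0 e1
      exact fr_pt (hh x e2)
    | up r j hj =>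
      simp only [R, n] at *
      rcases eq_or_ne k l with rfl | hne
      · exact fr_refl hk
      rcases hc r with e | ⟨x, hx, e1, -, e2⟩
      · omega
      · have := (hh x e1).up hx j hj
        exact fr_convex this (Nat.zero_le _) hkl (by omega)
    | dn r j hj =>
      simp only [R, n] at *
      rcases eq_or_ne k l with rfl | hne
      · exact fr_refl hk
      rcases hc r with e | ⟨x, hx, e1, e3, e2⟩
      · omega
      · have := (hh x e1).dn e3 hx j hj
        exact fr_convex this (by omega) hkl hl
  obtain ⟨b, k, hk⟩ := u
  obtain ⟨b', l, hl⟩ := v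
  obtain ⟨e, h⟩ := h
  simp only at e h
  subst e
  rcases le_total k l with e | e
  · exact (key b k l e hk hl h).2.2
  · have : R W mP mL b l k := by
      revert h
      cases b <;> simp only [R] <;> grind
    exact θ.symm (key b l k e hl hk this).2.2

end Wt
/-! ### The concrete geometry -/

inductive SS (Q : Type u) (G : Type v) : Type (max u v)
  | q : Q → SS Q G
  | g : G → SS Q G

noncomputable instance (Q : Type u) (G : Type v) : LinearOrder (SS Q G) :=
  IsWellOrder.linearOrder WellOrderingRel

instance (Q : Type u) (G : Type v) : WellFoundedLT (SS Q G) :=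
  ⟨(inferInstance : IsWellFounded (SS Q G) WellOrderingRel).wf⟩

inductive Ln (Q : Type u) [PartialOrder Q] (G : Type v) : Type (max u v)
  | k1 (s t : SS Q G) (h : s ≤ t) : Ln Q G
  | k3 (q p : Q) (h : p ≤ q) : Ln Q G
  | k4 (g s : G) : Ln Q G

inductive Val (Q : Type u) [PartialOrder Q] (G : Type v) : Type (max u v)
  | s : SS Q G → Val Q G
  | q : Q → Val Q G
  | g : G → Val Q G
  | priv : Ln Q G → Val Q G

namespace Con

variable {Q : Type u} [PartialOrder Q] {G : Type v} [Group G]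

def len : Ln Q G → ℕ
  | .k1 _ _ _ => 5
  | .k3 _ _ _ => 6
  | .k4 _ _ => 14

def coord : Ln Q G → ℕ → Val Q G
  | .k1 s t h, i => if i = 0 then .s s else if i = 1 then .s t else .priv (.k1 s t h)
  | .k3 q p h, i => if i = 0 then .s (.q q) else if i = 2 then .q p else .priv (.k3 q p h)
  | .k4 g s, i => if i = 0 then .s (.g s) else if i = 3 then .g g else
      if i = 4 then .g (g * s) else .priv (.k4 g s)

theorem lin (r s : Ln Q G) (i j : ℕ) (hij : i ≠ j) (h1 : coord r i = coord s i)
    (h2 : coord r j = coord s j) : r = s := by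
  cases r <;> cases s <;> simp only [coord] at h1 h2 <;> split_ifs at h1 h2 <;> simp_all

variable (Q G) in
def X : Geo (Ln Q G) (Val Q G) where
  len := len
  coord := coord
  three_le r := by cases r <;> simp [len]
  lin := lin
  off r := by
    cases r with
    | k4 => exact ⟨.k1 (.g 1) (.g 1) le_rfl, 2, by simp [len], by simp [coord]⟩
    | k1 => exact ⟨.k4 1 1, 5, by simp [len], by simp [coord]⟩
    | k3 => exact ⟨.k4 1 1, 5, by simp [len], by simp [coord]⟩

theorem nonempty_Ln : Nonempty (Ln Q G) := ⟨.k4 1 1⟩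

def col : ℕ → Val Q G → Option Q
  | 0, .s (.q q) => some q
  | 2, .q p => some p
  | _, _ => none

open Classical in
noncomputable def mV (D : Q → Prop) : Option Q → ℕ
  | some q => if D q then 1 else 0
  | none => 0

noncomputable def mP (D : Q → Prop) (x : (X Q G).Pt) : ℕ := mV D (col x.i x.v)

open Classical in
noncomputable def mL (D : Q → Prop) : Ln Q G → ℕ
  | .k1 (.q q) _ _ => if D q then 1 else 0
  | .k1 (.g _) _ _ => 0
  | .k3 q p _ => if q = p then (if D q then 1 else 0) else
      if D q then 2 else if D p then 1 else 0
  | .k4 _ _ => 0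

open Classical in
noncomputable def cc : Ln Q G → ℕ → ℕ
  | .k3 q p _, i => if i = 0 ∧ q ≠ p then 2 else 1
  | _, _ => 1

/-- The colour of the `i`-th point of a line. -/
def colL : Ln Q G → ℕ → Option Q
  | .k1 (.q q) _ _, i => if i = 0 then some q else none
  | .k3 q p _, i => if i = 0 then some q else if i = 2 then some p else none
  | _, _ => none

theorem col_coord (r : Ln Q G) (i : ℕ) : col i (coord r i) = colL r i := by
  rcases i with _ | _ | _ | i
  · rcases r with ⟨_ | _⟩ | _ | _ <;> simp [col, colL, coord]
  · rcases r with ⟨_ | _⟩ | _ | _ <;> simp [col, colL, coord]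
  · rcases r with ⟨_ | _⟩ | _ | _ <;> simp [col, colL, coord]
  · rcases r with ⟨_ | _⟩ | _ | _ <;> simp [col, colL, coord]

theorem mP_inc (D : Q → Prop) {r : Ln Q G} {x : (X Q G).Pt} (h : (X Q G).inc r x) :
    mP D x = mV D (colL r x.i) := by
  unfold mP
  rw [← h.2]
  exact congrArg _ (col_coord r x.i)

theorem hL (D : Q → Prop) (hD : ∀ p q, p ≤ q → D q → D p) (r : Ln Q G) (x : (X Q G).Pt)
    (h : (X Q G).inc r x) : cc r x.i * mP D x ≤ mL D r := by
  rw [mP_inc D h]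
  rcases r with ⟨_ | _⟩ | ⟨q, p, hpq⟩ | _ 
  · simp only [colL, mL, cc]; split_ifs <;> simp_all [mV]
  · simp [colL, mL, cc, mV]
  · have := hD p q hpq
    simp only [colL, mL, cc]; split_ifs <;> simp_all [mV]
  · simp [colL, mL, cc, mV]

theorem hM (D : Q → Prop) (hD : ∀ p q, p ≤ q → D q → D p) (r : Ln Q G) (x : (X Q G).Pt)
    (h : (X Q G).inc r x) : min (mP (fun _ => True) x) (mL D r / cc r x.i) ≤ mP D x := by
  rw [mP_inc D h, mP_inc _ h]
  rcases r with ⟨_ | _⟩ | ⟨q, p, hpq⟩ | _ 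
  · simp only [colL, mL, cc]; split_ifs <;> simp_all [mV]
  · simp [colL, mL, cc, mV]
  · have := hD p q hpq
    simp only [colL, mL, cc]; split_ifs <;> simp_all [mV] 
  · simp [colL, mL, cc, mV]

variable (Q G) in
noncomputable def W : Wt (X Q G) where
  nP := mP fun _ => True
  nL := mL fun _ => True
  c := cc
  c_pos r i := by
    cases r <;> simp only [cc] <;> try split_ifs
    all_goals simp
  cond := hL _ (fun _ _ _ _ => trivial)

theorem hP (D : Q → Prop) (x : (X Q G).Pt) : mP D x = 0 ∨ mP D x = (W Q G).nP x := by
  change _ ∨ _ = mP _ x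
  unfold mP
  cases col x.i x.v <;> simp [mV]; tauto

theorem nP_le (x : (X Q G).Pt) : (W Q G).nP x ≤ 1 := by
  change mP _ x ≤ 1
  unfold mP
  cases col x.i x.v <;> simp [mV]

theorem len_nL (r : Ln Q G) : (X Q G).len r + (W Q G).nL r ≤ 14 := by
  change len r + mL _ r ≤ 14
  rcases r with ⟨_ | _⟩ | _ | _ <;> simp only [len, mL] <;> try split_ifs
  all_goals simp_all

noncomputable def θD (D : Q → Prop) (hD : ∀ p q, p ≤ q → D q → D p) : LatCon (W Q G).L :=
  Wt.cong (mP D) (mL D) (hP D) (hL D hD) (hM D hD)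

variable (G) in
/-- The base point of colour `q`. -/
def xq (q : Q) : (X Q G).Pt := ⟨0, .s (.q q), .k3 q q le_rfl, by simp [X, len], rfl⟩

variable (G) in
def xt (q : Q) : (X Q G).Pt := ⟨2, .q q, .k3 q q le_rfl, by simp [X, len], rfl⟩

theorem inc_xq (q p : Q) (h : p ≤ q) : (X Q G).inc (.k3 q p h) (xq G q) :=
  ⟨by simp [X, len, xq], by simp [X, coord, xq]⟩

theorem inc_xt (q p : Q) (h : p ≤ q) : (X Q G).inc (.k3 q p h) (xt G p) :=
  ⟨by simp [X, len, xt], by simp [X, coord, xt]⟩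

theorem inc_xq1 (q : Q) (t h) : (X Q G).inc (.k1 (.q q) t h) (xq G q) :=
  ⟨by simp [X, len, xq], by simp [X, coord, xq]⟩

open Classical in
theorem mP_xq (D : Q → Prop) (q : Q) : mP D (xq G q) = if D q then 1 else 0 := rfl
open Classical in
theorem mP_xt (D : Q → Prop) (q : Q) : mP D (xt G q) = if D q then 1 else 0 := rfl

theorem nP_xq (q : Q) : (W Q G).nP (xq G q) = 1 := by
  change mP (fun _ => True) (xq G q) = 1
  rw [mP_xq]; simp
theorem nP_xt (q : Q) : (W Q G).nP (xt G q) = 1 := by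
  change mP (fun _ => True) (xt G q) = 1
  rw [mP_xt]; simp

theorem eq_of_mP {D : Q → Prop} {x : (X Q G).Pt} (h : mP D x ≠ 0) :
    ∃ q, D q ∧ (x = xq G q ∨ x = xt G q) := by
  obtain ⟨i, v, hx⟩ := x
  unfold mP at h
  rcases i with _ | _ | _ | i
  · rcases v with ⟨q | _⟩ | _ | _ | _ <;> simp [col, mV] at h
    exact ⟨q, h, Or.inl rfl⟩
  · rcases v with ⟨q | _⟩ | _ | _ | _ <;> simp [col, mV] at h
  · rcases v with ⟨q | _⟩ | q | _ | _ <;> simp [col, mV] at h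
    exact ⟨q, h, Or.inr rfl⟩
  · rcases v with ⟨q | _⟩ | _ | _ | _ <;> simp [col, mV] at h

open Wt

theorem hit_xt {θ : LatCon (W Q G).L} {q : Q} (h : Hit θ (xq G q)) : Hit θ (xt G q) :=
  hit_trans h (inc_xq q q le_rfl) (inc_xt q q le_rfl) (nP_xt q) (by simp [W, cc])

theorem hit_xq {θ : LatCon (W Q G).L} {q : Q} (h : Hit θ (xt G q)) : Hit θ (xq G q) :=
  hit_trans h (inc_xt q q le_rfl) (inc_xq q q le_rfl) (nP_xq q) (by simp [W, cc])

theorem hit_le {θ : LatCon (W Q G).L} {q p : Q} (hpq : p ≤ q) (h : Hit θ (xq G q)) :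
    Hit θ (xq G p) := by
  apply hit_xq
  refine hit_trans h (inc_xq q p hpq) (inc_xt q p hpq) (nP_xt p) ?_
  simp only [W, cc, xt, xq]
  split_ifs <;> simp_all

theorem mL_wit (D : Q → Prop) (hD : ∀ p q, p ≤ q → D q → D p) (r : Ln Q G) :
    mL D r = 0 ∨ ∃ x, (X Q G).inc r x ∧ mP D x = 1 ∧ (W Q G).nP x = 1 ∧ (W Q G).c r x.i = mL D r := by
  rcases r with ⟨q | _⟩ | ⟨q, p, hpq⟩ | _
  · simp only [mL]
    split_ifs with h
    · right
      exact ⟨xq G q, inc_xq1 _ _ _, by simp [mP_xq, h], nP_xq q, rfl⟩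
    · left; rfl
  · left; rfl
  · by_cases hq : D q
    · right
      refine ⟨xq G q, inc_xq _ _ _, by simp [mP_xq, hq], nP_xq q, ?_⟩
      have hp : D p := hD _ _ hpq hq
      by_cases e : q = p <;> simp [W, mL, cc, hq, hp, e, xq]
    · by_cases hp : D p
      · right
        refine ⟨xt G p, inc_xt _ _ _, by simp [mP_xt, hp], nP_xt p, ?_⟩
        have e : q ≠ p := by rintro rfl; exact hq hp
        simp [W, mL, cc, hq, hp, e, xt]
      · left
        simp [mL, hq, hp]
  · left; rfl

theorem θD_sub {D : Q → Prop} {hD} {θ : LatCon (W Q G).L} (h : ∀ q, D q → Hit θ (xq G q))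
    {u v : (W Q G).L} (huv : (θD D hD).rel u v) : θ.rel u v := by
  refine cong_sub nP_le (mL_wit D hD) ?_ huv
  intro x hx
  obtain ⟨q, hq, rfl | rfl⟩ := eq_of_mP (by omega : mP D x ≠ 0)
  · exact h q hq
  · exact hit_xt (h q hq)

/-- Every cell of a line is witnessed by a coloured point. -/
theorem cell_wit (r : Ln Q G) (k l : ℕ) (hkl : k < l) (hl : l ≤ (W Q G).nL r) :
    ∃ q x, (X Q G).inc r x ∧ (x = xq G q ∨ x = xt G q) ∧ k < (W Q G).c r x.i ∧
      (W Q G).c r x.i ≤ l ∧ l ≤ mL (· ≤ q) r := by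
  rcases r with ⟨q | _⟩ | ⟨q, p, hpq⟩ | _ <;> simp only [W, mL] at hl
  · refine ⟨q, xq G q, inc_xq1 _ _ _, Or.inl rfl, ?_⟩
    simp [W, mL, cc, xq] at *
    omega
  · omega
  · by_cases e : q = p
    · subst e
      refine ⟨q, xq G q, inc_xq _ _ _, Or.inl rfl, ?_⟩
      simp [W, mL, cc, xq] at *
      omega
    · simp [e] at hl
      by_cases hl2 : l = 1
      · refine ⟨p, xt G p, inc_xt _ _ _, Or.inr rfl, ?_⟩
        simp [W, mL, cc, xt, e] at *
        split_ifs <;> omega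
      · refine ⟨q, xq G q, inc_xq _ _ _, Or.inl rfl, ?_⟩
        simp [W, mL, cc, xq, e] at *
        omega
  · omega

theorem R_hit (b : (X Q G).BB) (k l : ℕ) (hkl : k < l) (hl : l ≤ (W Q G).n b) :
    ∃ q, R (W Q G) (mP (· ≤ q)) (mL (· ≤ q)) b k l ∧
      ∀ θ : LatCon (W Q G).L, Fib.Tot.fr θ b k l → Hit θ (xq G q) := by
  cases b with
  | bot => simp only [n] at hl; omega
  | top => simp only [n] at hl; omega
  | pt x i =>
    have h1 := nP_le x
    simp only [n] at hl
    have e0 : k = 0 := by omega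
    have e1 : l = 1 := by omega
    subst e0 e1
    have hx : mP (fun _ => True) x ≠ 0 := by change (W Q G).nP x ≠ 0; omega
    obtain ⟨q, -, rfl | rfl⟩ := eq_of_mP hx
    · refine ⟨q, ?_, fun θ h => fr_pt h⟩
      right
      rw [nP_xq, mP_xq]; simp
    · refine ⟨q, ?_, fun θ h => hit_xq (fr_pt h)⟩
      right
      rw [nP_xt, mP_xt]; simp
  | up r j hj =>
    simp only [n] at hl
    obtain ⟨q, x, hx, h1, h2, h3, h4⟩ := cell_wit r k l hkl hl
    refine ⟨q, Or.inr ⟨by omega, h4⟩, fun θ h => ?_⟩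
    rcases h1 with rfl | rfl
    · exact hit_of_up h (nP_xq q) hx h2 h3
    · exact hit_xq (hit_of_up h (nP_xt q) hx h2 h3)
  | dn r j hj =>
    simp only [n] at hl
    obtain ⟨q, x, hx, h1, h2, h3, h4⟩ := cell_wit r ((W Q G).nL r - l) ((W Q G).nL r - k)
      (by omega) (by omega)
    refine ⟨q, Or.inr ⟨by omega, by omega⟩, fun θ h => ?_⟩
    rcases h1 with rfl | rfl
    · exact hit_of_dn h (nP_xq q) hx h3 h2
    · exact hit_xq (hit_of_dn h (nP_xt q) hx h3 h2)

end Con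
namespace Con

open Wt

section Generic

variable {Q : Type u} [PartialOrder Q] {G : Type v} [Group G]

theorem hit_θD {D : Q → Prop} {hD} {q : Q} : Hit (θD (G := G) D hD) (xq G q) ↔ D q := by
  constructor
  · rintro ⟨h1, h2, -, h⟩
    rcases h with h | h
    · simp at h
    · rw [nP_xq, mP_xq] at h
      by_contra hq
      simp [hq] at h
  · intro hq
    have h1 : 1 ≤ (W Q G).F.n (.pt (xq G q) 0) := (nP_xq (G := G) q).ge
    refine ⟨Nat.zero_le _, h1, rfl, Or.inr ?_⟩
    rw [nP_xq, mP_xq]; simp [hq]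

theorem latCg_eq {D : Q → Prop} {hD} {a b : (W Q G).L} (h : (θD D hD).rel a b)
    (h' : ∀ θ : LatCon (W Q G).L, θ.rel a b → ∀ q, D q → Hit θ (xq G q)) :
    latCg a b = (θD D hD).rel := by
  funext u v
  apply propext
  constructor
  · intro e
    exact e _ h
  · intro e θ hθ
    exact θD_sub (h' θ hθ) e

theorem latCg_OT : latCg (W Q G).O (W Q G).T = fun _ _ => True := by
  funext u v
  apply propext
  simp only [iff_true]
  intro θ h
  exact full_of_OT h u v

theorem latCg_self (hD) (a : (W Q G).L) : latCg a a = (θD (fun _ => False) hD).rel :=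
  latCg_eq (LatCon.refl _ _) (fun _ _ _ h => h.elim)

theorem latCg_xq (q : Q) (hD) (h1 : 1 ≤ (W Q G).F.n (.pt (xq G q) 0)) :
    latCg (⟨.pt (xq G q) 0, 0, Nat.zero_le _⟩ : (W Q G).L) ⟨.pt (xq G q) 0, 1, h1⟩ =
      (θD (· ≤ q) hD).rel := by
  apply latCg_eq
  · exact (hit_θD (D := (· ≤ q)) (hD := hD).2 (le_refl q)).2.2
  · intro θ hθ p hp
    exact hit_le hp ⟨_, h1, hθ⟩

theorem latCg_cases {a b : (W Q G).L} (hab : a ≤ b) :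
    (latCg a b = fun _ _ => True) ∨ (∃ hD, latCg a b = (θD (fun _ => False) hD).rel) ∨
      ∃ q hD, latCg a b = (θD (· ≤ q) hD).rel := by
  by_cases hb : a.b = b.b
  · right
    obtain ⟨c, k, hk⟩ := a
    obtain ⟨c', l, hl⟩ := b
    simp only at hb
    subst hb
    have hkl : k ≤ l := Fib.Tot.mk_le.1 hab
    rcases eq_or_lt_of_le hkl with rfl | hkl
    · left
      exact ⟨fun _ _ _ h => h, latCg_self _ _⟩
    · right
      obtain ⟨q, h1, h2⟩ := R_hit c k l hkl hl
      refine ⟨q, fun _ _ h1 h2 => h1.trans h2, latCg_eq ⟨rfl, h1⟩ ?_⟩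
      intro θ hθ p hp
      exact hit_le hp (h2 θ ⟨hk, hl, hθ⟩)
  · left
    funext u v
    apply propext
    simp only [iff_true]
    intro θ h
    exact full_of_ne nonempty_Ln hb h u v

end Generic

variable (P : Type u) [PartialOrder P] [BoundedOrder P] [Nontrivial P] (G : Type v) [Group G]

abbrev PQ := {p : P // p ≠ ⊥ ∧ p ≠ ⊤}

variable {P}

theorem hDp (p : P) : ∀ a b : PQ P, a ≤ b → (b : P) ≤ p → (a : P) ≤ p :=
  fun _ _ h1 h2 => le_trans (α := P) h1 h2

noncomputable def Rp (p : P) : (W (PQ P) G).L → (W (PQ P) G).L → Prop :=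
  fun u v => p = ⊤ ∨ (θD (fun q : PQ P => (q : P) ≤ p) (hDp p)).rel u v

theorem Rp_top : Rp G (⊤ : P) = fun _ _ => True := by
  funext u v; simp [Rp]

theorem Rp_ne {p : P} (h : p ≠ ⊤) :
    Rp G p = (θD (fun q : PQ P => (q : P) ≤ p) (hDp p)).rel := by
  funext u v; simp [Rp, h]

theorem Rp_bot (hD) : Rp G (⊥ : P) = (θD (fun _ : PQ P => False) hD).rel := by
  rw [Rp_ne G bot_ne_top]
  congr 2
  funext q
  simp [q.2.1]

theorem Rp_mem (p : P) : ∃ a b : (W (PQ P) G).L, a ≤ b ∧ Rp G p = latCg a b := by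
  by_cases h1 : p = ⊤
  · subst h1
    exact ⟨(W (PQ P) G).O, (W (PQ P) G).T, O_le _, by rw [Rp_top, latCg_OT]⟩
  by_cases h0 : p = ⊥
  · subst h0
    refine ⟨(W (PQ P) G).O, (W (PQ P) G).O, le_rfl, ?_⟩
    rw [latCg_self (fun _ _ _ h => h), Rp_bot]
  · let q : PQ P := ⟨p, h0, h1⟩
    have e1 : 1 ≤ (W (PQ P) G).F.n (.pt (xq G q) 0) := (nP_xq (G := G) q).ge
    refine ⟨⟨.pt (xq G q) 0, 0, Nat.zero_le _⟩, ⟨.pt (xq G q) 0, 1, e1⟩,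
      Fib.Tot.mk_le.2 (by omega), ?_⟩
    rw [latCg_xq q (hDp p), Rp_ne G h1]
    rfl

theorem Rp_le (p p' : P) : Rp G p ≤ Rp G p' ↔ p ≤ p' := by
  by_cases h' : p' = ⊤
  · subst h'
    rw [Rp_top]
    simp only [le_top, iff_true]
    intro u v _
    trivial
  have nOT : ¬ Rp G p' (W (PQ P) G).O (W (PQ P) G).T := by
    rw [Rp_ne G h']
    rintro ⟨h, -⟩
    simp [O, T, Geo.BB.top_def, Geo.BB.bot_def] at h
  by_cases h : p = ⊤
  · subst h
    rw [Rp_top, top_le_iff]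
    simp only [h', iff_false]
    intro h
    exact nOT (h _ _ trivial)
  rw [Rp_ne G h, Rp_ne G h']
  constructor
  · intro hle
    by_cases h0 : p = ⊥
    · subst h0; exact bot_le
    let q : PQ P := ⟨p, h0, h⟩
    have e1 : Hit (θD (fun q : PQ P => (q : P) ≤ p) (hDp p)) (xq G q) := hit_θD.2 (le_refl p)
    have e2 : Hit (θD (fun q : PQ P => (q : P) ≤ p') (hDp p')) (xq G q) :=
      ⟨e1.1, e1.2.1, hle _ _ e1.2.2⟩
    exact hit_θD (D := fun q : PQ P => (q : P) ≤ p').1 e2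
  · intro hle u v huv
    refine θD_sub ?_ huv
    intro q hq
    exact hit_θD.2 (le_trans hq hle)

noncomputable def princEmb : P ↪o Princ (W (PQ P) G).L :=
  OrderEmbedding.ofMapLEIff (fun p => ⟨Rp G p, Rp_mem G p⟩) (fun p p' => Rp_le G p p')

theorem princ_surj : Function.Surjective (princEmb (P := P) G) := by
  rintro ⟨r, a, b, hab, rfl⟩
  rcases latCg_cases hab with h | ⟨hD, h⟩ | ⟨q, hD, h⟩
  · exact ⟨⊤, Subtype.ext ((Rp_top G).trans h.symm)⟩
  · exact ⟨⊥, Subtype.ext ((Rp_bot G hD).trans h.symm)⟩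
  · exact ⟨q, Subtype.ext ((Rp_ne G q.2.2).trans h.symm)⟩

theorem princIso : Nonempty (Princ (W (PQ P) G).L ≃o P) :=
  ⟨(RelIso.ofSurjective (princEmb G) (princ_surj G)).symm⟩

end Con
namespace Con

open Wt Geo

variable {Q : Type u} [PartialOrder Q] {G : Type v} [Group G]

/-! #### The action of the group -/

def actLn (a : G) : Ln Q G → Ln Q G
  | .k4 g s => .k4 (a * g) s
  | r => r

def actVal (a : G) : Val Q G → Val Q G
  | .g h => .g (a * h)
  | .priv r => .priv (actLn a r)
  | v => v

theorem actLn_mul (a b : G) (r : Ln Q G) : actLn (a * b) r = actLn a (actLn b r) := by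
  cases r <;> simp [actLn, mul_assoc]

theorem actLn_one (r : Ln Q G) : actLn 1 r = r := by
  cases r <;> simp [actLn]

theorem actVal_mul (a b : G) (v : Val Q G) : actVal (a * b) v = actVal a (actVal b v) := by
  cases v <;> simp [actVal, mul_assoc, actLn_mul]

theorem actVal_one (v : Val Q G) : actVal 1 v = v := by
  cases v <;> simp [actVal, actLn_one]

theorem len_act (a : G) (r : Ln Q G) : (X Q G).len (actLn a r) = (X Q G).len r := by
  cases r <;> simp [actLn, X, len]

theorem len_act' (a : G) (r : Ln Q G) : len (actLn a r) = len r := by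
  cases r <;> simp [actLn, len]

theorem coord_act (a : G) (r : Ln Q G) (i : ℕ) :
    (X Q G).coord (actLn a r) i = actVal a ((X Q G).coord r i) := by
  cases r <;> simp only [X, coord, actLn] <;> split_ifs <;> simp [actVal, actLn, mul_assoc]

theorem col_act (a : G) (i : ℕ) (v : Val Q G) : col i (actVal a v) = col i v := by
  rcases i with _ | _ | _ | i <;> rcases v with ⟨_ | _⟩ | _ | _ | _ <;> simp [col, actVal]

def actPt (a : G) (x : (X Q G).Pt) : (X Q G).Pt :=
  ⟨x.i, actVal a x.v, by
    obtain ⟨r, h1, h2⟩ := x.h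
    exact ⟨actLn a r, by rwa [len_act], by rw [coord_act, h2]⟩⟩

theorem actPt_mul (a b : G) (x : (X Q G).Pt) : actPt (a * b) x = actPt a (actPt b x) := by
  ext
  · rfl
  · exact actVal_mul a b x.v

theorem actPt_one (x : (X Q G).Pt) : actPt 1 x = x := by
  ext
  · rfl
  · exact actVal_one x.v

theorem inc_act (a : G) {r : Ln Q G} {x : (X Q G).Pt} (h : (X Q G).inc r x) :
    (X Q G).inc (actLn a r) (actPt a x) :=
  ⟨by rw [len_act]; exact h.1, by rw [coord_act]; exact congrArg _ h.2⟩

def actBB (a : G) : (X Q G).BB → (X Q G).BB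
  | .bot => .bot
  | .top => .top
  | .pt x k => .pt (actPt a x) k
  | .up r j h => .up (actLn a r) j (by rwa [len_act])
  | .dn r j h => .dn (actLn a r) j (by rwa [len_act])

theorem actBB_mul (a b : G) (x : (X Q G).BB) : actBB (a * b) x = actBB a (actBB b x) := by
  cases x <;> simp [actBB, actPt_mul, actLn_mul]

theorem actBB_one (x : (X Q G).BB) : actBB 1 x = x := by
  cases x <;> simp [actBB, actPt_one, actLn_one]

theorem actBB_le (a : G) {x y : (X Q G).BB} (h : x ≤ y) : actBB a x ≤ actBB a y := by
  rw [BB.le_def] at *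
  cases x <;> cases y <;> simp only [BB.le, actBB] at * <;> try grind
  · exact ⟨h.1, inc_act a h.2.1, h.2.2⟩
  · exact ⟨h.1, inc_act a h.2.1, h.2.2⟩

theorem nP_act (a : G) (x : (X Q G).Pt) : (W Q G).nP (actPt a x) = (W Q G).nP x := by
  simp only [W, mP, actPt, col_act]

theorem nL_act (a : G) (r : Ln Q G) : (W Q G).nL (actLn a r) = (W Q G).nL r := by
  cases r <;> simp only [W, actLn, mL]

theorem c_act (a : G) (r : Ln Q G) (i : ℕ) : (W Q G).c (actLn a r) i = (W Q G).c r i := by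
  cases r <;> simp only [W, actLn, cc]

theorem n_act (a : G) (b : (X Q G).BB) : (W Q G).n (actBB a b) = (W Q G).n b := by
  cases b <;> simp only [n, actBB, nP_act, nL_act]

theorem f_act (a : G) (b b' : (X Q G).BB) (k : ℕ) :
    (W Q G).f (actBB a b) (actBB a b') k = (W Q G).f b b' k := by
  cases b <;> cases b' <;> simp only [Wt.f, actBB, nP_act, nL_act, c_act] <;> rfl

noncomputable def actL (a : G) (u : (W Q G).L) : (W Q G).L :=
  ⟨actBB a u.b, u.k, u.h.trans_eq (n_act a u.b).symm⟩

theorem actL_mul (a b : G) (u : (W Q G).L) : actL (a * b) u = actL a (actL b u) := by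
  ext
  · exact actBB_mul a b u.b
  · rfl

theorem actL_one (u : (W Q G).L) : actL 1 u = u := by
  ext
  · exact actBB_one u.b
  · rfl

theorem actL_le (a : G) {u v : (W Q G).L} (h : u ≤ v) : actL a u ≤ actL a v :=
  ⟨actBB_le a h.1, (f_act a u.b v.b u.k).trans_le h.2⟩

theorem actL_inv (a : G) (u : (W Q G).L) : actL a⁻¹ (actL a u) = u := by
  rw [← actL_mul, inv_mul_cancel, actL_one]

noncomputable def actIso (a : G) : (W Q G).L ≃o (W Q G).L where
  toFun := actL a
  invFun := actL a⁻¹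
  left_inv := actL_inv a
  right_inv u := by simpa using actL_inv a⁻¹ u
  map_rel_iff' := by
    intro u v
    refine ⟨fun h => ?_, fun h => actL_le a h⟩
    have := actL_le a⁻¹ h
    simp only [Equiv.coe_fn_mk] at this
    rwa [actL_inv, actL_inv] at this

variable (Q G) in
noncomputable def actHom : G →* ((W Q G).L ≃o (W Q G).L) where
  toFun := actIso
  map_one' := by
    apply DFunLike.ext
    intro u
    exact actL_one u
  map_mul' a b := by
    apply DFunLike.ext
    intro u
    exact actL_mul a b u

theorem actHom_inj : Function.Injective (actHom Q G) := by
  intro a b h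
  have h0 : 0 < (X Q G).len (.k4 1 1 : Ln Q G) := by simp [X, len]
  have := congrArg (fun σ : (W Q G).L ≃o (W Q G).L => (σ ((W Q G).z (.up (.k4 1 1) 0 h0))).b) h
  simpa [actHom, actIso, actL, z, actBB, actLn] using this

/-! #### Rigidity of the geometry -/

structure Good (ρ : Ln Q G → Ln Q G) : Prop where
  len : ∀ r, len (ρ r) = len r
  coord : ∀ r s i, i < Con.len r → i < Con.len s → coord r i = coord s i →
    coord (ρ r) i = coord (ρ s) i

namespace Good

variable {ρ ρ' : Ln Q G → Ln Q G}

theorem k1 (h : Good ρ) (s t hst) : ∃ s' t' h', ρ (.k1 s t hst) = .k1 s' t' h' := by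
  have := h.len (.k1 s t hst)
  revert this
  generalize ρ (.k1 s t hst) = r
  cases r <;> simp [Con.len]
  assumption

theorem k3 (h : Good ρ) (q p hqp) : ∃ q' p' h', ρ (.k3 q p hqp) = .k3 q' p' h' := by
  have := h.len (.k3 q p hqp)
  revert this
  generalize ρ (.k3 q p hqp) = r
  cases r <;> simp [Con.len]
  assumption

theorem k4 (h : Good ρ) (g s) : ∃ g' s', ρ (.k4 g s) = .k4 g' s' := by
  have := h.len (.k4 g s)
  revert this
  generalize ρ (.k4 g s) = r
  cases r <;> simp [Con.len]

theorem k1_split (h : Good ρ) : ∃ α β : SS Q G → SS Q G, ∀ s t hst, ∃ h',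
    ρ (.k1 s t hst) = .k1 (α s) (β t) h' := by
  choose s' t' h' e using h.k1
  refine ⟨fun s => s' s s le_rfl, fun t => t' t t le_rfl, fun s t hst => ?_⟩
  have e1 := h.coord (.k1 s t hst) (.k1 s s le_rfl) 0 (by simp [Con.len]) (by simp [Con.len])
    (by simp [Con.coord])
  have e2 := h.coord (.k1 s t hst) (.k1 t t le_rfl) 1 (by simp [Con.len]) (by simp [Con.len])
    (by simp [Con.coord])
  rw [e, e] at e1 e2
  simp [Con.coord] at e1 e2
  have e3 := h' s t hst
  refine ⟨by beta_reduce; rwa [← e1, ← e2], ?_⟩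
  rw [e]
  simp [e1, e2]

theorem k1_fix (h : Good ρ) (h' : Good ρ') (h1 : ∀ r, ρ' (ρ r) = r) (h2 : ∀ r, ρ (ρ' r) = r)
    (s t hst) : ρ (.k1 s t hst) = .k1 s t hst := by
  obtain ⟨α, β, e⟩ := h.k1_split
  obtain ⟨α', β', e'⟩ := h'.k1_split
  have a1 : ∀ s, α' (α s) = s ∧ β' (β s) = s := by
    intro s
    obtain ⟨x, hx⟩ := e s s le_rfl
    obtain ⟨y, hy⟩ := e' _ _ x
    have := h1 (.k1 s s le_rfl)
    rw [hx, hy] at this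
    simpa using this
  have a2 : ∀ s, α (α' s) = s ∧ β (β' s) = s := by
    intro s
    obtain ⟨x, hx⟩ := e' s s le_rfl
    obtain ⟨y, hy⟩ := e _ _ x
    have := h2 (.k1 s s le_rfl)
    rw [hx, hy] at this
    simpa using this
  have b : ∀ s t, s ≤ t ↔ α s ≤ β t := by
    intro s t
    constructor
    · intro hst
      exact (e s t hst).1
    · intro hst
      have := (e' _ _ hst).1
      rwa [(a1 s).1, (a1 t).2] at this
  have m : StrictMono α := by
    apply Monotone.strictMono_of_injective
    · intro s1 s2 h12
      have c := (b s2 (β' (α s2))).2 (by rw [(a2 _).2])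
      have := (b s1 (β' (α s2))).1 (h12.trans c)
      rwa [(a2 _).2] at this
    · intro s1 s2 h12
      rw [← (a1 s1).1, h12, (a1 s2).1]
  have i : ∀ s, α s = s := by
    intro s
    apply le_antisymm _ m.le_apply
    have : α' (α s) = s := (a1 s).1
    by_contra hlt
    push Not at hlt
    have : ∀ n : ℕ, True := fun _ => trivial
    have hm : α' (α s) < α s := by rw [(a1 s).1]; exact hlt
    have m' : StrictMono α' := by
      intro x y hxy
      by_contra hc
      push Not at hc
      have := m.monotone hc
      rw [(a2 _).1, (a2 _).1] at this
      exact absurd hxy (not_lt.2 this)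
    exact absurd m'.le_apply (not_le.2 hm)
  have j : ∀ t, β t = t := by
    intro t
    apply le_antisymm
    · rw [b, i]
    · have := (b t t).1 le_rfl
      rwa [i] at this
  obtain ⟨h', e⟩ := e s t hst
  rw [e]
  simp [i, j]

theorem k3_split (h : Good ρ) (hfix : ∀ s t hst, ρ (.k1 s t hst) = .k1 s t hst) :
    ∃ γ : Q → Q, ∀ q p hqp, ∃ h', ρ (.k3 q p hqp) = .k3 q (γ p) h' := by
  choose q' p' h' e using h.k3
  refine ⟨fun p => p' p p le_rfl, fun q p hqp => ?_⟩
  have e1 := h.coord (.k3 q p hqp) (.k1 (.q q) (.q q) le_rfl) 0 (by simp [Con.len])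
    (by simp [Con.len]) (by simp [Con.coord])
  have e2 := h.coord (.k3 q p hqp) (.k3 p p le_rfl) 2 (by simp [Con.len]) (by simp [Con.len])
    (by simp [Con.coord])
  rw [e, e] at e2
  rw [e, hfix] at e1
  simp [Con.coord] at e1 e2
  have e3 := h' q p hqp
  refine ⟨by beta_reduce; rw [← e2]; exact e3.trans_eq e1, ?_⟩
  rw [e]
  simp [e1, e2]

theorem k3_fix (h : Good ρ) (h' : Good ρ') (h1 : ∀ r, ρ' (ρ r) = r) (h2 : ∀ r, ρ (ρ' r) = r)
    (q p hqp) : ρ (.k3 q p hqp) = .k3 q p hqp := by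
  obtain ⟨γ, e⟩ := h.k3_split (h.k1_fix h' h1 h2)
  obtain ⟨γ', e'⟩ := h'.k3_split (h'.k1_fix h h2 h1)
  have key : γ p = p := by
    obtain ⟨x, hx⟩ := e p p le_rfl
    obtain ⟨y, hy⟩ := e' _ _ x
    obtain ⟨z, -⟩ := e' (γ p) (γ p) le_rfl
    have := h1 (.k3 p p le_rfl)
    rw [hx, hy] at this
    simp at this
    rw [this] at z
    exact le_antisymm x z
  obtain ⟨h', e⟩ := e q p hqp
  rw [e]
  simp [key]

theorem k4_act (h : Good ρ) (hfix : ∀ s t hst, ρ (.k1 s t hst) = .k1 s t hst) :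
    ∃ a : G, ∀ g s, ρ (.k4 g s) = .k4 (a * g) s := by
  choose g' s' e using h.k4
  have es : ∀ g s, s' g s = s := by
    intro g s
    have e1 := h.coord (.k4 g s) (.k1 (.g s) (.g s) le_rfl) 0 (by simp [Con.len])
      (by simp [Con.len]) (by simp [Con.coord])
    rw [e, hfix] at e1
    simpa [Con.coord] using e1
  have eg : ∀ g s, g' g s = g' g 1 := by
    intro g s
    have e1 := h.coord (.k4 g s) (.k4 g 1) 3 (by simp [Con.len])
      (by simp [Con.len]) (by simp [Con.coord])
    rw [e, e] at e1
    simpa [Con.coord] using e1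
  have em : ∀ s, g' 1 1 * s = g' s 1 := by
    intro s
    have e1 := h.coord (.k4 1 s) (.k4 s 1) 4 (by simp [Con.len])
      (by simp [Con.len]) (by simp [Con.coord])
    rw [e, e] at e1
    simpa [Con.coord, es, eg 1 s] using e1
  refine ⟨g' 1 1, fun g s => ?_⟩
  rw [e, es, eg, em]

theorem act (h : Good ρ) (h' : Good ρ') (h1 : ∀ r, ρ' (ρ r) = r) (h2 : ∀ r, ρ (ρ' r) = r) :
    ∃ a : G, ∀ r, ρ r = actLn a r := by
  obtain ⟨a, ha⟩ := h.k4_act (h.k1_fix h' h1 h2)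
  refine ⟨a, fun r => ?_⟩
  cases r with
  | k1 s t hst => exact h.k1_fix h' h1 h2 s t hst
  | k3 q p hqp => exact h.k3_fix h' h1 h2 q p hqp
  | k4 g s => exact ha g s

end Good

theorem good_of {ρ : Ln Q G → Ln Q G} {τ : (X Q G).Pt → (X Q G).Pt}
    (h1 : ∀ r, (X Q G).len r = (X Q G).len (ρ r))
    (h2 : ∀ r x, (X Q G).inc r x → (X Q G).inc (ρ r) (τ x) ∧ (τ x).i = x.i) : Good ρ := by
  refine ⟨fun r => (h1 r).symm, fun r s i hr hs e => ?_⟩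
  let x := (X Q G).p r i hr
  have a1 := h2 r x ⟨hr, rfl⟩
  have a2 := h2 s x ⟨hs, e.symm⟩
  have c1 := a1.1.2
  have c2 := a2.1.2
  rw [a1.2] at c1 c2
  exact c1.trans c2.symm

theorem baseAut_act (σ : (X Q G).BB ≃o (X Q G).BB) : ∃ a : G, ∀ b, σ b = actBB a b := by
  obtain ⟨ρ, τ, h1, h2, h3, h4, h5⟩ := BB.aut_main σ
  obtain ⟨ρ', τ', h1', h2', h3', h4', h5'⟩ := BB.aut_main σ.symm
  have pos : ∀ r : Ln Q G, 0 < (X Q G).len r := fun r => by have := (X Q G).three_le r; omega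
  have i1 : ∀ r, ρ' (ρ r) = r := by
    intro r
    obtain ⟨x, hx⟩ := h2 r 0 (pos r)
    obtain ⟨y, hy⟩ := h2' (ρ r) 0 x
    rw [← hx, OrderIso.symm_apply_apply] at hy
    simp at hy
    exact hy.symm
  have i2 : ∀ r, ρ (ρ' r) = r := by
    intro r
    obtain ⟨x, hx⟩ := h2' r 0 (pos r)
    obtain ⟨y, hy⟩ := h2 (ρ' r) 0 x
    rw [← hx, OrderIso.apply_symm_apply] at hy
    simp at hy
    exact hy.symm
  obtain ⟨a, ha⟩ := (good_of h4 h5).act (good_of h4' h5') i1 i2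
  refine ⟨a, fun b => ?_⟩
  cases b with
  | bot => exact map_bot σ
  | top => exact map_top σ
  | pt x k =>
    rw [h1]
    have : τ x = actPt a x := by
      obtain ⟨r, hr⟩ := x.h
      have hx : (X Q G).inc r x := hr
      obtain ⟨e1, e2⟩ := h5 r x hx
      rw [ha] at e1
      exact inc_i e1 (inc_act a hx) e2
    rw [this]; rfl
  | up r j h =>
    obtain ⟨h', e⟩ := h2 r j h
    rw [e]
    simp only [actBB, ha]
  | dn r j h =>
    obtain ⟨h', e⟩ := h3 r j h
    rw [e]
    simp only [actBB, ha]

theorem actHom_surj : Function.Surjective (actHom Q G) := by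
  intro σ
  obtain ⟨a, ha⟩ := baseAut_act (baseAut nonempty_Ln σ)
  refine ⟨a, ?_⟩
  have key : ∀ u, (σ.trans (actIso a⁻¹)) u = u := by
    apply aut_trivial
    intro u
    change actBB a⁻¹ (σ u).b = u.b
    rw [baseAut_b nonempty_Ln, ha, ← actBB_mul, inv_mul_cancel, actBB_one]
  apply DFunLike.ext
  intro u
  have := congrArg (actL a) (key u)
  change actL a (actL a⁻¹ (σ u)) = actL a u at this
  rw [← actL_mul, mul_inv_cancel, actL_one] at this
  exact this.symm

theorem autIso : Nonempty (G ≃* ((W Q G).L ≃o (W Q G).L)) :=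
  ⟨MulEquiv.ofBijective (actHom Q G) ⟨actHom_inj, actHom_surj⟩⟩

end Con

/-- **Theorem.** If `P` is a bounded ordered set with at least two elements and `G` is an
arbitrary group, then there exists a selfdual lattice `L` of length sixteen such that
`Princ L` and `Aut L` are isomorphic to `P` and `G`, respectively. -/
theorem representation_of_poset_and_group
    (P : Type u) [PartialOrder P] [BoundedOrder P] [Nontrivial P]
    (G : Type v) [Group G] :
    ∃ (L : Type (max u v)) (_ : Lattice L),
      Nonempty (L ≃o Lᵒᵈ) ∧ LatLength L 16 ∧
      Nonempty (Princ L ≃o P) ∧ Nonempty (G ≃* (L ≃o L)) := by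
  exact ⟨(Con.W (Con.PQ P) G).L, inferInstance, ⟨Wt.dualIso _⟩,
    Wt.length16 Con.nP_le Con.len_nL ⟨.k4 1 1, rfl⟩, Con.princIso G, Con.autIso⟩
end

section
/- There exists an assignment S of a lattice S(α) to every ordinal α such that each S(α) is a simple, selfdual, automorphism-rigid lattice of length 12, and for all ordinals α and β, S(α) is isomorphic (as a lattice) to S(β) if and only if α = β. -/
/-- A lattice is simple if it has at least two elements and its only congruences
are the equality congruence `Δ` and the full congruence `∇`. -/
def IsSimpleLat (L : Type*) [Lattice L] : Prop :=
  Nontrivial L ∧ ∀ θ : LatCon L, (∀ x y, θ.rel x y ↔ x = y) ∨ (∀ x y, θ.rel x y)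

namespace RSF

universe u

inductive K (W : Type u) [LinearOrder W] : Type u
  | a (i : W) : K W
  | b (j : W) : K W
  | e (i j : W) (h : i ≤ j) : K W
  | c (k : Fin 10) : K W
  | x (k : Fin 9) : K W

variable {W : Type u} [LinearOrder W]

namespace K

/-- the order of `K` -/
def le : K W → K W → Prop
  | a i, a j => i = j
  | a i, e j _ _ => i = j
  | a _, c _ => True
  | b i, b j => i = j
  | b i, e _ j _ => i = j
  | e i j _, e i' j' _ => i = i' ∧ j = j'
  | c k, c l => k.val ≤ l.val
  | x k, x l => k.val = l.val
  | x k, c l => k.val < l.val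
  | _, _ => False

instance : PartialOrder (K W) where
  le := le
  le_refl p := by cases p <;> simp [le]
  le_trans p q r := by
    cases p <;> cases q <;> cases r <;> simp [le] <;> grind
  le_antisymm p q := by
    cases p <;> cases q <;> simp [le] <;> grind

theorem le_def (p q : K W) : p ≤ q ↔ le p q := Iff.rfl

def sup : K W → K W → Option (K W)
  | a i, a j => if i = j then some (a i) else some (c 0)
  | a i, b j => if h : i ≤ j then some (e i j h) else none
  | b j, a i => if h : i ≤ j then some (e i j h) else none
  | a i, e j k h => if i = j then some (e j k h) else none
  | e j k h, a i => if i = j then some (e j k h) else none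
  | a _, c k => some (c k)
  | c k, a _ => some (c k)
  | a _, x k => some (c k.succ)
  | x k, a _ => some (c k.succ)
  | b i, b j => if i = j then some (b i) else none
  | b i, e j k h => if i = k then some (e j k h) else none
  | e j k h, b i => if i = k then some (e j k h) else none
  | e i j h, e i' j' _ => if i = i' ∧ j = j' then some (e i j h) else none
  | c k, c l => some (c (max k l))
  | c k, x l => some (c (max k l.succ))
  | x l, c k => some (c (max k l.succ))
  | x l, x k => if l = k then some (x k) else some (c (max k.succ l.succ))
  | _, _ => none

def inf : K W → K W → Option (K W)
  | a i, a j => if i = j then some (a i) else none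
  | a i, e j _ _ => if i = j then some (a i) else none
  | e j _ _, a i => if i = j then some (a i) else none
  | a i, c _ => some (a i)
  | c _, a i => some (a i)
  | b i, b j => if i = j then some (b i) else none
  | b i, e _ k _ => if i = k then some (b i) else none
  | e _ k _, b i => if i = k then some (b i) else none
  | e i j h, e i' j' _ => if i = i' then (if j = j' then some (e i j h) else some (a i))
      else (if j = j' then some (b j) else none)
  | e i _ _, c _ => some (a i)
  | c _, e i _ _ => some (a i)
  | c k, c l => some (c (min k l))
  | c k, x l => if l.val < k.val then some (x l) else none
  | x l, c k => if l.val < k.val then some (x l) else none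
  | x l, x k => if l = k then some (x k) else none
  | _, _ => none

set_option maxHeartbeats 4000000 in
theorem sup_spec (p q r : K W) : (p ≤ r ∧ q ≤ r) ↔ ∃ m, sup p q = some m ∧ m ≤ r := by
  simp only [le_def]
  cases p <;> cases q <;> cases r <;> simp only [sup] <;> (try split_ifs) <;> simp [le] <;> grind

set_option maxHeartbeats 4000000 in
theorem inf_spec (p q r : K W) : (r ≤ p ∧ r ≤ q) ↔ ∃ m, inf p q = some m ∧ r ≤ m := by
  simp only [le_def]
  cases p <;> cases q <;> cases r <;> simp only [inf] <;> (try split_ifs) <;> simp [le] <;> grind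

def rk : K W → ℕ
  | a _ => 1
  | b _ => 1
  | e _ _ _ => 2
  | c k => k.val + 2
  | x _ => 1

theorem rk_lt {p q : K W} (h : p < q) : rk p < rk q := by
  rw [lt_iff_le_and_ne, le_def] at h
  cases p <;> cases q <;> simp [le, rk] at h ⊢ <;> grind

theorem rk_bd (p : K W) : 0 < rk p ∧ rk p < 12 := by
  cases p <;> simp [rk]
  omega

end K

inductive S (W : Type u) [LinearOrder W] : Type u
  | bot : S W
  | top : S W
  | up (p : K W) : S W
  | dn (p : K W) : S W

namespace S

def le : S W → S W → Prop
  | bot, _ => True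
  | _, top => True
  | up p, up q => p ≤ q
  | dn p, dn q => q ≤ p
  | _, _ => False

instance : PartialOrder (S W) where
  le := le
  le_refl p := by cases p <;> simp [le]
  le_trans p q r := by
    cases p <;> cases q <;> cases r <;> simp [le] <;> grind
  le_antisymm p q := by
    cases p <;> cases q <;> simp [le] <;> grind

theorem le_def (p q : S W) : p ≤ q ↔ le p q := Iff.rfl

def δ : S W → S W
  | bot => top
  | top => bot
  | up p => dn p
  | dn p => up p

@[simp] theorem δδ (s : S W) : δ (δ s) = s := by cases s <;> rfl

theorem δ_le (s t : S W) : δ s ≤ δ t ↔ t ≤ s := by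
  simp only [le_def]
  cases s <;> cases t <;> simp [δ, le]

def inf : S W → S W → S W
  | bot, _ => bot
  | _, bot => bot
  | top, s => s
  | s, top => s
  | up p, up q => match K.inf p q with
    | some m => up m
    | none => bot
  | dn p, dn q => match K.sup p q with
    | some m => dn m
    | none => bot
  | _, _ => bot

theorem inf_spec (s t r : S W) : r ≤ inf s t ↔ (r ≤ s ∧ r ≤ t) := by
  simp only [le_def]
  cases s with
  | bot => cases t <;> cases r <;> simp [le, inf]
  | top => cases t <;> cases r <;> simp [le, inf]
  | up p =>
    cases t with
    | bot => cases r <;> simp [le, inf]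
    | top => cases r <;> simp [le, inf]
    | dn q => cases r <;> simp [le, inf]
    | up q =>
      have h := K.inf_spec p q
      cases hm : K.inf p q <;> cases r <;> simp [le, inf, hm] at h ⊢ <;> grind
  | dn p =>
    cases t with
    | bot => cases r <;> simp [le, inf]
    | top => cases r <;> simp [le, inf]
    | up q => cases r <;> simp [le, inf]
    | dn q =>
      have h := K.sup_spec p q
      cases hm : K.sup p q <;> cases r <;> simp [le, inf, hm] at h ⊢ <;> grind

instance : Lattice (S W) where
  inf := inf
  sup s t := δ (inf (δ s) (δ t))
  inf_le_left s t := ((inf_spec s t _).1 le_rfl).1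
  inf_le_right s t := ((inf_spec s t _).1 le_rfl).2
  le_inf r s t h1 h2 := (inf_spec s t r).2 ⟨h1, h2⟩
  le_sup_left s t := by
    rw [← δ_le, δδ]; exact ((inf_spec _ _ _).1 le_rfl).1
  le_sup_right s t := by
    rw [← δ_le, δδ]; exact ((inf_spec _ _ _).1 le_rfl).2
  sup_le s t r h1 h2 := by
    rw [← δ_le, δδ]; exact (inf_spec _ _ _).2 ⟨(δ_le _ _).2 h1, (δ_le _ _).2 h2⟩

theorem inf_def (s t : S W) : s ⊓ t = inf s t := rfl
theorem δ_sup (s t : S W) : δ (s ⊔ t) = δ s ⊓ δ t := δδ _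
theorem δ_inf (s t : S W) : δ (s ⊓ t) = δ s ⊔ δ t := by
  change _ = δ (inf (δ (δ s)) (δ (δ t))); simp [inf_def]
theorem sup_def (s t : S W) : s ⊔ t = δ (inf (δ s) (δ t)) := rfl

def rk : S W → ℕ
  | bot => 0
  | top => 12
  | up p => K.rk p
  | dn p => 12 - K.rk p

theorem rk_le (s : S W) : rk s ≤ 12 := by
  cases s <;> simp [rk]
  exact (K.rk_bd _).2.le

theorem rk_lt {s t : S W} (h : s < t) : rk s < rk t := by
  rw [lt_iff_le_and_ne, le_def] at h
  have := fun (p q : K W) (h1 : p ≤ q) (h2 : p ≠ q) => K.rk_lt (lt_of_le_of_ne h1 h2)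
  have := @K.rk_bd W _
  cases s <;> cases t <;> simp [le, rk] at h ⊢ <;> grind

/-! ### duality of congruences and simplicity -/

def dualCon (θ : LatCon (S W)) : LatCon (S W) where
  rel s t := θ.rel (δ s) (δ t)
  refl _ := θ.refl _
  symm h := θ.symm h
  trans h h' := θ.trans h h'
  sup h h' := by rw [δ_sup, δ_sup]; exact θ.inf h h'
  inf h h' := by rw [δ_inf, δ_inf]; exact θ.sup h h'

theorem full_of_bot_top (θ : LatCon (S W)) (h : θ.rel bot top) (s t : S W) : θ.rel s t := by
  have key : ∀ s : S W, θ.rel bot s := fun s => by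
    have := θ.inf h (θ.refl s)
    simp only [inf_def] at this
    cases s <;> simpa [inf] using this
  exact θ.trans (θ.symm (key s)) (key t)

theorem full_of_bot [Nonempty W] (θ : LatCon (S W)) (s : S W) (hs : s ≠ bot) (h : θ.rel bot s) :
    ∀ s t, θ.rel s t := by
  obtain ⟨w⟩ := ‹Nonempty W›
  apply full_of_bot_top
  cases s with
  | bot => exact absurd rfl hs
  | top => exact h
  | up p =>
    have h1 := θ.sup h (θ.refl (dn (K.b w)))
    have h2 := θ.sup h (θ.refl (dn (K.c 0)))
    have := θ.inf h1 h2
    simpa [inf_def, sup_def, inf, δ, K.sup] using this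
  | dn p =>
    have h1 := θ.sup h (θ.refl (up (K.b w)))
    have h2 := θ.sup h (θ.refl (up (K.c 0)))
    have := θ.inf h1 h2
    simpa [inf_def, sup_def, inf, δ, K.inf] using this

theorem full_of_up [Nontrivial W] (θ : LatCon (S W)) (p q : K W) (hpq : p < q)
    (h : θ.rel (up p) (up q)) : ∀ s t, θ.rel s t := by
  have main : ∀ r : K W, K.inf p r = none → K.inf q r = some r → ∀ s t, θ.rel s t := by
    intro r h1 h2
    refine full_of_bot θ (up r) (by simp) ?_
    have := θ.inf h (θ.refl (up r))
    simpa [inf_def, inf, h1, h2] using this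
  rw [lt_iff_le_and_ne, K.le_def] at hpq
  cases p with
  | a i =>
    cases q <;> simp [K.le] at hpq
    case e i' j _ => exact main (K.b j) (by simp [K.inf]) (by simp [K.inf])
    case c k =>
      obtain ⟨i', hi⟩ := exists_ne i
      exact main (K.a i') (by simp [K.inf, hi.symm]) (by simp [K.inf])
  | b j =>
    cases q <;> simp [K.le] at hpq
    case e i j' _ => exact main (K.a i) (by simp [K.inf]) (by simp [K.inf])
  | e => cases q <;> simp [K.le] at hpq; grind
  | c k =>
    cases q <;> simp [K.le] at hpq
    case c l =>
      have : k.val < l.val := by grind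
      refine main (K.x ⟨l.val - 1, by omega⟩) ?_ ?_ <;> simp [K.inf] <;> omega
  | x k =>
    cases q <;> simp [K.le] at hpq
    case x => grind
    case c =>
      obtain ⟨i⟩ := (inferInstance : Nonempty W)
      exact main (K.a i) (by simp [K.inf]) (by simp [K.inf])

theorem full_of_lt [Nontrivial W] (θ : LatCon (S W)) (s t : S W) (hst : s < t)
    (h : θ.rel s t) : ∀ s t, θ.rel s t := by
  have dual : (∀ s t, (dualCon θ).rel s t) → ∀ s t, θ.rel s t := by
    intro H s t
    simpa [dualCon] using H (δ s) (δ t)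
  have h' := hst
  rw [lt_iff_le_and_ne, le_def] at h'
  cases s with
  | bot => exact full_of_bot θ t h'.2.symm h
  | top => cases t <;> simp [le] at h'
  | up p =>
    cases t <;> simp [le] at h'
    case top => exact dual (full_of_bot _ (dn p) (by simp) (θ.symm h))
    case up q => exact full_of_up θ p q (lt_iff_le_and_ne.2 h') h
  | dn p =>
    cases t <;> simp [le] at h'
    case top => exact dual (full_of_bot _ (up p) (by simp) (θ.symm h))
    case dn q =>
      exact dual (full_of_up _ q p (lt_iff_le_and_ne.2 ⟨h'.1, Ne.symm h'.2⟩) (θ.symm h))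

theorem simple [Nontrivial W] : IsSimpleLat (S W) := by
  refine ⟨⟨bot, top, by simp⟩, fun θ => ?_⟩
  by_cases hθ : ∀ x y, θ.rel x y → x = y
  · exact Or.inl fun x y => ⟨hθ x y, fun h => h ▸ θ.refl x⟩
  · right
    push Not at hθ
    obtain ⟨x, y, h, hne⟩ := hθ
    have h1 : θ.rel (x ⊓ y) (x ⊔ y) := by
      have e1 := θ.inf h (θ.refl y)
      have e2 := θ.sup (θ.refl y) h
      simp only [inf_idem, sup_idem] at e1 e2
      exact θ.trans e1 (by simpa [sup_comm] using θ.symm e2)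
    exact full_of_lt θ _ _ (inf_lt_sup.2 hne) h1

/-! ### length -/

def ch (w : W) (n : Fin 13) : S W :=
  if n.val = 0 then bot else if n.val = 1 then up (K.a w) else
    if h : n.val < 12 then up (K.c ⟨n.val - 2, by omega⟩) else top

theorem ch_mono (w : W) {m n : Fin 13} (h : m ≤ n) : ch w m ≤ ch w n := by
  have h : m.val ≤ n.val := h
  rw [le_def]
  unfold ch
  split_ifs <;> simp [le, K.le_def, K.le] <;> omega

theorem rk_ch (w : W) (n : Fin 13) : rk (ch w n) = n.val := by
  unfold ch
  split_ifs <;> simp [rk, K.rk] <;> omega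

theorem length [Nonempty W] : LatLength (S W) 12 := by
  obtain ⟨w⟩ := ‹Nonempty W›
  refine ⟨⟨Set.range (ch w), ?_, Set.finite_range _, ?_⟩, ?_⟩
  · rintro _ ⟨m, rfl⟩ _ ⟨n, rfl⟩ _
    rcases le_total m n with h | h
    · exact Or.inl (ch_mono w h)
    · exact Or.inr (ch_mono w h)
  · rw [Set.ncard_range_of_injective]
    · simp
    · intro m n h
      have := congrArg rk h
      rw [rk_ch, rk_ch] at this
      exact Fin.ext this
  · intro C hC
    have inj : Set.InjOn rk C := by
      intro s hs t ht h
      by_contra hne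
      rcases hC hs ht hne with h' | h'
      · exact absurd h (rk_lt (lt_of_le_of_ne h' hne)).ne
      · exact absurd h (rk_lt (lt_of_le_of_ne h' (Ne.symm hne))).ne'
    have maps : Set.MapsTo rk C (Set.Iic 12) := fun s _ => rk_le s
    refine ⟨Set.Finite.of_injOn maps inj (Set.finite_Iic 12), ?_⟩
    have := Set.ncard_le_ncard_of_injOn rk maps inj (Set.finite_Iic 12)
    simpa [Set.ncard_eq_toFinset_card'] using this

/-! ### isomorphisms -/

def dual : S W ≃o (S W)ᵒᵈ where
  toFun s := OrderDual.toDual (δ s)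
  invFun s := δ (OrderDual.ofDual s)
  left_inv s := by simp
  right_inv s := by simp
  map_rel_iff' {s t} := by
    change δ t ≤ δ s ↔ _
    exact δ_le _ _

variable {V : Type u} [LinearOrder V]

def conj (f : S W ≃o S V) : S W ≃o S V where
  toFun s := δ (f (δ s))
  invFun s := δ (f.symm (δ s))
  left_inv s := by simp
  right_inv s := by simp
  map_rel_iff' {s t} := by
    change δ (f (δ s)) ≤ δ (f (δ t)) ↔ _
    rw [δ_le, f.le_iff_le, δ_le]

theorem lt_def (s t : S W) : s < t ↔ le s t ∧ s ≠ t := lt_iff_le_and_ne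

theorem f_bot (f : S W ≃o S V) : f bot = bot := by
  have : f bot ≤ f (f.symm bot) := f.le_iff_le.2 (by simp [le_def, le])
  rw [f.apply_symm_apply, le_def] at this
  cases h : f bot <;> simp_all [le]

theorem f_top (f : S W ≃o S V) : f top = top := by
  have : f (f.symm top) ≤ f top := f.le_iff_le.2 (by rw [le_def]; cases f.symm top <;> simp [le])
  rw [f.apply_symm_apply, le_def] at this
  cases h : f top <;> simp_all [le]

theorem rk_fc [Nonempty W] (f : S W ≃o S V) (k : Fin 10) : rk (f (up (K.c k))) = k.val + 2 := by
  obtain ⟨w⟩ := ‹Nonempty W›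
  have st : ∀ m n : Fin 13, m < n → rk (f (ch w m)) < rk (f (ch w n)) := by
    intro m n h
    refine rk_lt (f.lt_iff_lt.2 (lt_of_le_of_ne (ch_mono w h.le) ?_))
    intro h'
    have := congrArg rk h'
    rw [rk_ch, rk_ch] at this
    omega
  have h12 := rk_le (f (ch w 12))
  have lo : ∀ n (h : n < 13), n ≤ rk (f (ch w ⟨n, h⟩)) := by
    intro n
    induction n with
    | zero => intro _; omega
    | succ n ih =>
      intro h
      have := ih (by omega)
      have := st ⟨n, by omega⟩ ⟨n+1, h⟩ (by simp [Fin.lt_def])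
      omega
  have hi : ∀ n (h : n < 13), rk (f (ch w ⟨12 - n, by omega⟩)) + n ≤ 12 := by
    intro n
    induction n with
    | zero => intro _; exact h12
    | succ n ih =>
      intro h
      have := ih (by omega)
      have := st ⟨12 - (n+1), by omega⟩ ⟨12 - n, by omega⟩ (by simp [Fin.lt_def]; omega)
      omega
  have hk := k.isLt
  have h1 := lo (k.val + 2) (by omega)
  have h2 := hi (12 - (k.val + 2)) (by omega)
  have e1 : (⟨12 - (12 - (k.val + 2)), by omega⟩ : Fin 13) = ⟨k.val + 2, by omega⟩ := by
    apply Fin.ext; simp; omega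
  rw [e1] at h2
  have e2 : ch w ⟨k.val + 2, by omega⟩ = up (K.c k) := by
    simp [ch, hk]
  rw [e2] at h1 h2
  omega

theorem f_c1 [Nonempty W] (f : S W ≃o S V) : f (up (K.c 1)) = up (K.c 1) := by
  have h1 := rk_fc f 1
  have h2 : f (up (K.c 0)) < f (up (K.c 1)) := f.lt_iff_lt.2 (by simp [lt_def, le, K.le_def, K.le])
  have h3 : f (up (K.x 0)) < f (up (K.c 1)) := f.lt_iff_lt.2 (by simp [lt_def, le, K.le_def, K.le])
  have h4 : ¬ f (up (K.c 0)) ≤ f (up (K.x 0)) := fun h => by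
    have := f.le_iff_le.1 h
    simp [le_def, le, K.le_def, K.le] at this
  have h5 : ¬ f (up (K.x 0)) ≤ f (up (K.c 0)) := fun h => by
    have := f.le_iff_le.1 h
    simp [le_def, le, K.le_def, K.le] at this
  generalize f (up (K.c 0)) = s at *
  generalize f (up (K.x 0)) = t at *
  generalize f (up (K.c 1)) = r at *
  rw [lt_def] at h2 h3
  rw [le_def] at h4 h5
  rcases r with _ | _ | r | r
  · simp [rk] at h1
  · simp [rk] at h1
  · cases r <;> simp [rk, K.rk] at h1
    congr 2
    apply Fin.ext; simp; omega
  · exfalso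
    cases r <;> simp [rk, K.rk] at h1
    case c k =>
      rcases s with _ | _ | s | s <;> simp [le] at h2 h4
      rcases t with _ | _ | t | t <;> simp [le] at h3 h4 h5
      rw [K.le_def] at h2 h3 h4 h5
      cases s <;> cases t <;> simp [K.le] at h2 h3 h4 h5
      omega

theorem f_c [Nonempty W] (f : S W ≃o S V) (k : Fin 10) : f (up (K.c k)) = up (K.c k) := by
  have h1 := rk_fc f k
  have hc := f_c1 f
  by_cases hk : k = 0
  · subst hk
    have h2 : f (up (K.c 0)) < f (up (K.c 1)) :=
      f.lt_iff_lt.2 (by simp [lt_def, le, K.le_def, K.le])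
    rw [hc] at h2
    generalize f (up (K.c 0)) = s at *
    rw [lt_def] at h2
    rcases s with _ | _ | s | s <;> simp [le, rk] at h2 h1
    rw [K.le_def] at h2
    cases s <;> simp [K.le, K.rk] at h1 h2 ⊢
    assumption
  · have h2 : f (up (K.c 1)) ≤ f (up (K.c k)) :=
      f.le_iff_le.2 (by simp [le_def, le, K.le_def, K.le]; omega)
    rw [hc] at h2
    generalize f (up (K.c k)) = s at *
    rw [le_def] at h2
    rcases s with _ | _ | s | s <;> simp [le, rk] at h2 h1
    · omega
    rw [K.le_def] at h2
    cases s <;> simp [K.le, K.rk] at h1 h2 ⊢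
    omega

theorem f_ne_bot (f : S W ≃o S V) {s : S W} (h : s ≠ bot) : f s ≠ bot := by
  rw [← f_bot f]; exact fun h' => h (f.injective h')

theorem f_ne_top (f : S W ≃o S V) {s : S W} (h : s ≠ top) : f s ≠ top := by
  rw [← f_top f]; exact fun h' => h (f.injective h')

theorem f_a [Nonempty W] (f : S W ≃o S V) (i : W) : ∃ i', f (up (K.a i)) = up (K.a i') := by
  have h : f (up (K.a i)) < f (up (K.c 0)) := f.lt_iff_lt.2 (by simp [lt_def, le, K.le_def, K.le])
  have h' := f_ne_bot f (s := up (K.a i)) (by simp)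
  rw [f_c] at h
  generalize f (up (K.a i)) = s at *
  rw [lt_def] at h
  rcases s with _ | _ | s | s <;> simp [le] at h h'
  rw [K.le_def] at h
  cases s <;> simp [K.le] at h ⊢

theorem f_x [Nonempty W] (f : S W ≃o S V) (k : Fin 9) : f (up (K.x k)) = up (K.x k) := by
  have h : f (up (K.x k)) < f (up (K.c k.succ)) :=
    f.lt_iff_lt.2 (by simp [lt_def, le, K.le_def, K.le])
  have h2 : ¬ f (up (K.x k)) ≤ f (up (K.c k.castSucc)) := fun h => by
    have := f.le_iff_le.1 h
    simp [le_def, le, K.le_def, K.le] at this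
  have h' := f_ne_bot f (s := up (K.x k)) (by simp)
  rw [f_c] at h h2
  generalize f (up (K.x k)) = s at *
  rw [lt_def] at h
  rw [le_def] at h2
  rcases s with _ | _ | s | s <;> simp [le] at h h' h2
  rw [K.le_def] at h h2
  cases s <;> simp [K.le] at h h2 ⊢
  all_goals grind

theorem f_e [Nonempty W] (f : S W ≃o S V) (i j : W) (hij : i ≤ j) :
    ∃ i' j' h', f (up (K.e i j hij)) = up (K.e i' j' h') := by
  have h : f (up (K.a i)) < f (up (K.e i j hij)) :=
    f.lt_iff_lt.2 (by simp [lt_def, le, K.le_def, K.le])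
  have h' := f_ne_top f (s := up (K.e i j hij)) (by simp)
  have h2 : ∀ k, f (up (K.e i j hij)) ≠ up (K.c k) := by
    intro k hk
    rw [← f_c f] at hk
    simpa using f.injective hk
  obtain ⟨i', hi⟩ := f_a f i
  rw [hi] at h
  generalize f (up (K.e i j hij)) = s at *
  rw [lt_def] at h
  rcases s with _ | _ | s | s <;> simp [le] at h h' h2
  rw [K.le_def] at h
  cases s <;> simp [K.le] at h h2 ⊢
  assumption

theorem f_b [Nonempty W] (f : S W ≃o S V) (j : W) : ∃ j', f (up (K.b j)) = up (K.b j') := by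
  have h : f (up (K.b j)) < f (up (K.e j j le_rfl)) :=
    f.lt_iff_lt.2 (by simp [lt_def, le, K.le_def, K.le])
  have h3 : ¬ f (up (K.b j)) ≤ f (up (K.c 0)) := fun h => by
    have := f.le_iff_le.1 h
    simp [le_def, le, K.le_def, K.le] at this
  have h' := f_ne_bot f (s := up (K.b j)) (by simp)
  obtain ⟨i', j', hij, he⟩ := f_e f j j le_rfl
  rw [he] at h
  rw [f_c] at h3
  generalize f (up (K.b j)) = s at *
  rw [lt_def] at h
  rw [le_def] at h3
  rcases s with _ | _ | s | s <;> simp [le] at h h' h3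
  rw [K.le_def] at h h3
  cases s <;> simp [K.le] at h h3 ⊢
  grind

theorem f_ab [Nonempty W] (f : S W ≃o S V) {i j : W} {i' j' : V}
    (hi : f (up (K.a i)) = up (K.a i')) (hj : f (up (K.b j)) = up (K.b j')) (hij : i ≤ j) :
    ∃ h' : i' ≤ j', f (up (K.e i j hij)) = up (K.e i' j' h') := by
  have h1 : f (up (K.a i)) ≤ f (up (K.e i j hij)) :=
    f.le_iff_le.2 (by simp [le_def, le, K.le_def, K.le])
  have h2 : f (up (K.b j)) ≤ f (up (K.e i j hij)) :=
    f.le_iff_le.2 (by simp [le_def, le, K.le_def, K.le])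
  obtain ⟨i₁, j₁, h₁, he⟩ := f_e f i j hij
  rw [he, hi] at h1
  rw [he, hj] at h2
  simp [le_def, le, K.le_def, K.le] at h1 h2
  subst h1 h2
  exact ⟨h₁, he⟩

theorem structure_thm [Nonempty W] [Nonempty V] (f : S W ≃o S V) :
    ∃ g : W ≃o V, (∀ i, f (up (K.a i)) = up (K.a (g i))) ∧
      (∀ i, f (up (K.b i)) = up (K.b (g i))) := by
  choose A hA using f_a f
  choose B hB using f_b f
  choose A' hA' using f_a f.symm
  choose B' hB' using f_b f.symm
  have hA'' : ∀ i, f (up (K.a (A' i))) = up (K.a i) := fun i => by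
    rw [← hA', f.apply_symm_apply]
  have hB'' : ∀ i, f (up (K.b (B' i))) = up (K.b i) := fun i => by
    rw [← hB', f.apply_symm_apply]
  have r1 : ∀ i, A (A' i) = i := fun i => by
    have := (hA (A' i)).symm.trans (hA'' i)
    simpa using this
  have r2 : ∀ i, B (B' i) = i := fun i => by
    have := (hB (B' i)).symm.trans (hB'' i)
    simpa using this
  have l1 : ∀ i, A' (A i) = i := fun i => by
    have := (hA'' (A i)).trans (hA i).symm
    simpa using f.injective this
  have l2 : ∀ i, B' (B i) = i := fun i => by
    have := (hB'' (B i)).trans (hB i).symm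
    simpa using f.injective this
  have key : ∀ i j, i ≤ j ↔ A i ≤ B j := by
    intro i j
    constructor
    · intro h
      exact (f_ab f (hA i) (hB j) h).1
    · intro h
      have := (f_ab f.symm (hA' (A i)) (hB' (B j)) h).1
      rwa [l1, l2] at this
  have mono : ∀ i k, A i ≤ A k ↔ i ≤ k := by
    intro i k
    constructor
    · intro h
      exact (key i k).2 (h.trans ((key k k).1 le_rfl))
    · intro h
      have := (key k (B' (A k))).2 (r2 _).ge
      have := (key i (B' (A k))).1 (h.trans this)
      rwa [r2] at this
  have AB : ∀ j, B j = A j := by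
    intro j
    apply le_antisymm
    · have := (key (A' (B j)) j).2 (r1 _).le
      rw [← mono, r1] at this
      exact this
    · exact (key j j).1 le_rfl
  refine ⟨⟨⟨A, A', l1, r1⟩, fun {i k} => mono i k⟩, hA, fun i => ?_⟩
  rw [hB, AB]; rfl

theorem up_fixed [Nonempty W] [WellFoundedLT W] (f : S W ≃o S W) (p : K W) :
    f (up p) = up p := by
  obtain ⟨g, ha, hb⟩ := structure_thm f
  have hg : g = OrderIso.refl W := Subsingleton.elim _ _
  subst hg
  cases p with
  | a i => exact ha i
  | b i => exact hb i
  | c k => exact f_c f k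
  | x k => exact f_x f k
  | e i j h => exact (f_ab f (ha i) (hb j) h).2

theorem rigid [Nonempty W] [WellFoundedLT W] (f : S W ≃o S W) : f = OrderIso.refl _ := by
  ext s
  cases s with
  | bot => exact f_bot f
  | top => exact f_top f
  | up p => exact up_fixed f p
  | dn p =>
    have := up_fixed (conj f) p
    change δ (f (dn p)) = up p at this
    have := congrArg δ this
    rwa [δδ] at this

end S

end RSF

/-- **Lemma.** There is an assignment `S` of a (bundled) lattice `S α` to every
ordinal `α` such that each `S α` is a simple, selfdual, automorphism-rigid lattice of
length `12`, and `S α ≅ S β` (as lattices) if and only if `α = β`. -/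
theorem exists_rigid_simple_selfdual_family :
    ∃ S : Ordinal.{u} → Lat.{u},
      (∀ α : Ordinal.{u},
        IsSimpleLat ↥(S α) ∧
        Nonempty (↥(S α) ≃o (↥(S α))ᵒᵈ) ∧
        (∀ f : ↥(S α) ≃o ↥(S α), f = OrderIso.refl ↥(S α)) ∧
        LatLength ↥(S α) 12) ∧
      (∀ α β : Ordinal.{u}, Nonempty (↥(S α) ≃o ↥(S β)) ↔ α = β) := by
  have nt : ∀ α : Ordinal.{u}, Nontrivial (2 + α).ToType := by
    intro α
    rw [← Cardinal.one_lt_iff_nontrivial, Cardinal.mk_toType, Ordinal.card_add]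
    refine lt_of_lt_of_le ?_ (self_le_add_right _ _)
    simp
  refine ⟨fun α => Lat.of (RSF.S (2 + α).ToType), fun α => ?_, fun α β => ⟨?_, ?_⟩⟩
  · have := nt α
    exact ⟨RSF.S.simple, ⟨RSF.S.dual⟩, RSF.S.rigid, RSF.S.length⟩
  · rintro ⟨f⟩
    have := nt α
    have := nt β
    obtain ⟨g, -⟩ := RSF.S.structure_thm f
    have := Ordinal.type_eq.2 ⟨g.toRelIsoLT⟩
    rw [Ordinal.type_toType, Ordinal.type_toType] at this
    exact (add_right_inj 2).1 this
  · rintro rfl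
    exact ⟨OrderIso.refl _⟩
end
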